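/- arXiv:1804.00439 — 3 statements merged into one kernel-verified Lean document; each statement's English description precedes it below -/
import Mathlib

section
/- Suppose that q(u) → +∞ as u → −∞, and that there exists ω₊ ∈ ℝ such that q(u) → ω₊ as u → +∞ with q(u) < ω₊ for all sufficiently large u. Then there exists s₀ ∈ (−∞, ω₊) such that: for s < s₀ the equation (WE_s) has no T-periodic solutions; for s = s₀ it has at least one T-periodic solution; for s₀ < s < ω₊ it has at least two T-periodic solutions; and for s ≥ ω₊ it has at least one T-periodic solution. -/
open MeasureTheory Set Filter

noncomputable section

/-- The Lebesgue measure restricted to the interval `[0,T]`. -/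
def muT (T : ℝ) : Measure ℝ := volume.restrict (Icc 0 T)

/-- `u` is a `C¹` function on `[0,T]` with derivative `u'` there, satisfying the
`T`-periodic boundary conditions `u 0 = u T` and `u' 0 = u' T`. -/
def IsC1Periodic (T : ℝ) (u u' : ℝ → ℝ) : Prop :=
  (∀ t ∈ Icc (0:ℝ) T, HasDerivWithinAt u (u' t) (Icc (0:ℝ) T) t) ∧
    ContinuousOn u' (Icc (0:ℝ) T) ∧ u 0 = u T ∧ u' 0 = u' T

/-- `φ ∘ u'` is absolutely continuous on `[0,T]`, being the indefinite integral of the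
integrable function `w` (which is then its a.e. derivative). -/
def IsACPhiDeriv (T : ℝ) (φ : ℝ → ℝ) (u' w : ℝ → ℝ) : Prop :=
  IntegrableOn w (Icc (0:ℝ) T) ∧
    ∀ t ∈ Icc (0:ℝ) T, φ (u' t) = φ (u' 0) + ∫ τ in (0:ℝ)..t, w τ

/-- `u` is a `T`-periodic solution of `(φ(u'))' + f(u)u' + a(t) q(u) = s + e(t)`. -/
def IsSolWE (T : ℝ) (φ f q a e : ℝ → ℝ) (s : ℝ) (u : ℝ → ℝ) : Prop :=
  ∃ u' w : ℝ → ℝ, IsC1Periodic T u u' ∧ IsACPhiDeriv T φ u' w ∧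
    ∀ᵐ t ∂(muT T), w t + f (u t) * u' t + a t * q (u t) = s + e t

section Brouwer

open scoped NNReal ENNReal Topology Manifold ContDiff

/-- Extending by zero a Lipschitz function on a closed ball that vanishes on its boundary. -/
theorem lipschitzWith_indicator_ball {E : Type*} [NormedAddCommGroup E]
    [NormedSpace ℝ E] {g : E → E} {R : ℝ} {K : ℝ≥0}
    (hg : LipschitzOnWith K g (Metric.closedBall 0 R)) (h0 : ∀ x, ‖x‖ = R → g x = 0) :
    LipschitzWith K ((Metric.ball (0 : E) R).indicator g) := by
  have hcross : ∀ x y : E, ‖x‖ < R → R ≤ ‖y‖ → ‖g x‖ ≤ K * ‖x - y‖ := by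
    intro x y hx hy
    have hcont : ContinuousOn (fun s : ℝ => ‖x + s • (y - x)‖) (Icc 0 1) := by fun_prop
    obtain ⟨s, hs, hsR⟩ := intermediate_value_Icc (zero_le_one' ℝ) hcont
      (show R ∈ Icc _ _ by simpa using ⟨hx.le, hy⟩)
    have h1 := hg.norm_sub_le (x := x) (y := x + s • (y - x)) (by simpa using hx.le)
      (by simpa using le_of_eq hsR)
    rw [h0 _ hsR, sub_zero] at h1
    refine h1.trans (mul_le_mul_of_nonneg_left ?_ K.coe_nonneg)
    rw [sub_add_cancel_left, norm_neg, norm_smul, Real.norm_of_nonneg hs.1, norm_sub_rev y x]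
    exact mul_le_of_le_one_left (norm_nonneg _) hs.2
  refine LipschitzWith.of_dist_le_mul fun x y => ?_
  rw [dist_eq_norm, dist_eq_norm]
  by_cases hx : ‖x‖ < R <;> by_cases hy : ‖y‖ < R
  · simpa [indicator, hx, hy] using hg.norm_sub_le (x := x) (y := y)
      (by simpa using hx.le) (by simpa using hy.le)
  · simpa [indicator, hx, hy] using hcross x y hx (not_lt.1 hy)
  · simpa [indicator, hx, hy, norm_sub_rev] using hcross y x hy (not_lt.1 hx)
  · simpa [indicator, hx, hy] using by positivity

variable {E : Type*} [NormedAddCommGroup E] [InnerProductSpace ℝ E] [FiniteDimensional ℝ E]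

/-- Extrapolation of real polynomials of degree at most `n` from `n + 1` nodes. -/
theorem exists_extrapolation_weights (n : ℕ) (v : ℕ → ℝ) (hv : Function.Injective v) (r : ℝ) :
    ∃ c : ℕ → ℝ, ∀ p : Polynomial ℝ, p.natDegree ≤ n →
      p.eval r = ∑ i ∈ Finset.range (n + 1), c i * p.eval (v i) := by
  refine ⟨fun i => (Lagrange.basis (Finset.range (n + 1)) v i).eval r, fun p hp => ?_⟩
  have hdeg : p.degree < (Finset.range (n + 1)).card := by
    rw [Finset.card_range]
    exact lt_of_le_of_lt Polynomial.degree_le_natDegree (by exact_mod_cast Nat.lt_succ_of_le hp)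
  conv_lhs => rw [Lagrange.eq_interpolate (s := Finset.range (n + 1)) (v := v) hv.injOn hdeg]
  rw [Lagrange.interpolate_apply, Polynomial.eval_finsetSum]
  refine Finset.sum_congr rfl fun i _ => ?_
  rw [Polynomial.eval_mul, Polynomial.eval_C, mul_comm]

theorem exists_polynomial_eval_eq_det (A : E →L[ℝ] E) :
    ∃ p : Polynomial ℝ, p.natDegree ≤ Module.finrank ℝ E ∧
      ∀ t : ℝ, p.eval t = (1 + t • A).det := by
  let b := Module.finBasis ℝ E
  let M := LinearMap.toMatrix b b (A : E →ₗ[ℝ] E)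
  refine ⟨Matrix.det ((Polynomial.X : Polynomial ℝ) • M.map Polynomial.C +
    (1 : Matrix _ _ ℝ).map Polynomial.C), ?_, fun t => ?_⟩
  · simpa using Polynomial.natDegree_det_X_add_C_le M 1
  · rw [ContinuousLinearMap.det, ← LinearMap.det_toMatrix b, ← Polynomial.coe_evalRingHom,
      RingHom.map_det]
    congr 1
    ext i j
    by_cases hij : i = j
    · subst hij
      simp [M, LinearMap.toMatrix_apply]
      ring
    · simp [M, LinearMap.toMatrix_apply, hij]
      ring

/-- A perturbation of the identity by a contraction vanishing outside a ball preserves the ball. -/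
theorem image_ball_of_contraction {g : E → E} {R : ℝ} {K : ℝ≥0} (hK : K < 1)
    (hg : LipschitzWith K g) (h0 : ∀ x, R ≤ ‖x‖ → g x = 0) :
    Function.Injective (fun x => x + g x) ∧
      (fun x => x + g x) '' Metric.ball 0 R = Metric.ball 0 R := by
  have hinj : Function.Injective (fun x => x + g x) := by
    intro x y hxy
    have h1 : x - y = g y - g x := by
      have : x + g x = y + g y := hxy
      rw [sub_eq_sub_iff_add_eq_add, this, add_comm]
    have h2 := hg.norm_sub_le y x
    rw [← h1, norm_sub_rev y x] at h2
    have h3 : (K : ℝ) < 1 := by exact_mod_cast hK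
    have h4 : ‖x - y‖ = 0 := by nlinarith [norm_nonneg (x - y)]
    exact sub_eq_zero.1 (norm_eq_zero.1 h4)
  refine ⟨hinj, Subset.antisymm ?_ ?_⟩
  · rintro _ ⟨x, hx, rfl⟩
    by_contra hy
    simp only [mem_ball_zero_iff, not_lt] at hx hy
    have h1 : (fun x => x + g x) (x + g x) = (fun x => x + g x) x := by
      simp [h0 _ hy]
    have h2 := hinj h1
    rw [h2] at hy
    linarith
  · intro y hy
    have hc : ContractingWith K (fun x => y - g x) :=
      ⟨hK, LipschitzWith.of_dist_le_mul fun a b => by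
        simpa [dist_eq_norm, norm_sub_rev] using hg.norm_sub_le b a⟩
    obtain ⟨x, hx⟩ : ∃ x, y - g x = x := ⟨_, hc.fixedPoint_isFixedPt⟩
    have hxy : x + g x = y := (sub_eq_iff_eq_add.1 hx).symm
    refine ⟨x, ?_, hxy⟩
    by_contra hx'
    simp only [mem_ball_zero_iff, not_lt] at hx' hy
    rw [h0 _ hx', add_zero] at hxy
    rw [hxy] at hx'
    linarith

variable [MeasurableSpace E] [BorelSpace E]

/-- The mean Jacobian determinant of a Lipschitz perturbation of the identity, supported in a
ball, is one. -/
theorem integral_det_one_add_fderiv {g : E → E} {R : ℝ} {K : ℝ≥0}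
    (hg : LipschitzWith K g) (h0 : ∀ x, R ≤ ‖x‖ → g x = 0)
    (hd : ∀ x ∈ Metric.ball (0 : E) R, DifferentiableAt ℝ g x) :
    ∫ x in Metric.ball (0 : E) R, (1 + fderiv ℝ g x).det =
      (volume : Measure E).real (Metric.ball (0 : E) R) := by
  have hbound : ∀ x, ‖fderiv ℝ g x‖ ≤ K := fun x => norm_fderiv_le_of_lipschitz ℝ hg
  have hfin : volume (Metric.ball (0 : E) R) ≠ ⊤ := measure_ball_lt_top.ne
  have hmeas : ∀ t : ℝ, Measurable fun x => (1 + t • fderiv ℝ g x).det := fun t =>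
    ContinuousLinearMap.continuous_det.measurable.comp
      (((measurable_fderiv ℝ g).const_smul t).const_add 1)
  have hintegrable : ∀ t : ℝ, IntegrableOn (fun x => (1 + t • fderiv ℝ g x).det)
      (Metric.ball (0 : E) R) := by
    intro t
    have hcpt : IsCompact (Metric.closedBall (0 : E →L[ℝ] E) K) := isCompact_closedBall _ _
    have hcont : Continuous fun A : E →L[ℝ] E => (1 + t • A).det :=
      ContinuousLinearMap.continuous_det.comp (by fun_prop)
    obtain ⟨C, hC⟩ := hcpt.exists_bound_of_continuousOn hcont.continuousOn
    exact Measure.integrableOn_of_bounded hfin (hmeas t).aestronglyMeasurable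
      (Eventually.of_forall fun x => hC _ (by simpa using hbound x)) 
  obtain ⟨δ, hδ, hpos⟩ : ∃ δ > 0, ∀ A : E →L[ℝ] E, ‖A‖ < δ → 0 < (1 + A).det := by
    have hcont : Continuous fun A : E →L[ℝ] E => (1 + A).det :=
      ContinuousLinearMap.continuous_det.comp (by fun_prop)
    have h1 : (0 : ℝ) < (1 + (0 : E →L[ℝ] E)).det := by
      rw [add_zero]
      simp [ContinuousLinearMap.det]
    obtain ⟨δ, hδ, h⟩ := Metric.mem_nhds_iff.1 (hcont.continuousAt.eventually (lt_mem_nhds h1))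
    exact ⟨δ, hδ, fun A hA => h (by simpa using hA)⟩
  obtain ⟨ε, hε, hεδ, hε1⟩ : ∃ ε : ℝ, 0 < ε ∧ ε * K < δ ∧ ε * K < 1 := by
    refine ⟨min δ 1 / (K + 1), by positivity, ?_, ?_⟩
    all_goals
      rw [div_mul_eq_mul_div, div_lt_iff₀ (by positivity)]
      nlinarith [min_le_left δ 1, min_le_right δ 1, K.coe_nonneg, lt_min hδ one_pos]
  have hsmall : ∀ t : ℝ, 0 < t → t ≤ ε → ∫ x in Metric.ball (0 : E) R,
      (1 + t • fderiv ℝ g x).det = (volume : Measure E).real (Metric.ball (0 : E) R) := by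
    intro t ht0 htε
    have htK : t * K ≤ ε * K := mul_le_mul_of_nonneg_right htε K.coe_nonneg
    have hL : LipschitzWith (t.toNNReal * K) fun x => t • g x :=
      LipschitzWith.of_dist_le_mul fun a b => by
        have h1 := hg.dist_le_mul a b
        have h2 : dist (t • g a) (t • g b) = t * dist (g a) (g b) := by
          rw [dist_smul₀, Real.norm_of_nonneg ht0.le]
        rw [h2]
        simp only [NNReal.coe_mul, Real.coe_toNNReal t ht0.le]
        rw [mul_assoc]
        exact mul_le_mul_of_nonneg_left h1 ht0.le
    have hlt : (t.toNNReal * K : ℝ≥0) < 1 := by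
      rw [← NNReal.coe_lt_coe]
      simp only [NNReal.coe_mul, Real.coe_toNNReal t ht0.le, NNReal.coe_one]
      linarith
    obtain ⟨hinj, himg⟩ := image_ball_of_contraction (R := R) hlt hL
      (fun x hx => by simp [h0 x hx])
    have hcv := lintegral_abs_det_fderiv_eq_addHaar_image (volume : Measure E)
      (s := Metric.ball (0 : E) R) (f := fun x => x + t • g x)
      (f' := fun x => 1 + t • fderiv ℝ g x) measurableSet_ball
      (fun x hx => ((hasFDerivAt_id x).add
        ((hd x hx).hasFDerivAt.const_smul t)).hasFDerivWithinAt) hinj.injOn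
    rw [himg] at hcv
    have hp : ∀ x, 0 < (1 + t • fderiv ℝ g x).det := fun x => hpos _ (by
      rw [norm_smul, Real.norm_of_nonneg ht0.le]
      exact lt_of_le_of_lt ((mul_le_mul_of_nonneg_left (hbound x) ht0.le).trans htK) hεδ)
    rw [integral_eq_lintegral_of_nonneg_ae (Eventually.of_forall fun x => (hp x).le)
      (hmeas t).aestronglyMeasurable, measureReal_def, ← hcv]
    simp_rw [abs_of_pos (hp _)]
  choose p hpdeg hpeval using fun x => exists_polynomial_eval_eq_det (fderiv ℝ g x)
  set n := Module.finrank ℝ E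
  let v : ℕ → ℝ := fun i => ε / (i + 1)
  have hv : Function.Injective v := by
    intro i j hij
    have h1 : (i : ℝ) + 1 = j + 1 := by
      have : ε / ((i : ℝ) + 1) = ε / (j + 1) := hij
      rw [div_eq_div_iff (by positivity) (by positivity)] at this
      exact (mul_left_cancel₀ hε.ne' this).symm
    exact_mod_cast add_right_cancel h1
  have hvpos : ∀ i, 0 < v i ∧ v i ≤ ε := fun i =>
    ⟨by positivity, div_le_self hε.le (by simp)⟩
  obtain ⟨c, hc⟩ := exists_extrapolation_weights n v hv 1
  have hsum : ∑ i ∈ Finset.range (n + 1), c i = 1 := by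
    have := hc 1 (by simp)
    simpa using this.symm
  have key : ∀ x, (1 + fderiv ℝ g x).det =
      ∑ i ∈ Finset.range (n + 1), c i * (1 + v i • fderiv ℝ g x).det := by
    intro x
    have := hc (p x) (hpdeg x)
    simp only [hpeval, one_smul] at this
    exact this
  simp_rw [key]
  rw [integral_finsetSum _ fun i _ => (hintegrable (v i)).const_mul (c i)]
  simp_rw [integral_const_mul, hsmall _ (hvpos _).1 (hvpos _).2]
  rw [← Finset.sum_mul, hsum, one_mul]

/-- A smooth self-map which is the identity outside a ball vanishes somewhere. -/
theorem exists_eq_zero_of_eq_id_outside {h : E → E} {R : ℝ} (hR : 0 < R)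
    (hh : ContDiff ℝ 1 h) (hid : ∀ x, R ≤ ‖x‖ → h x = x) : ∃ x, h x = 0 := by
  by_contra! hne
  let k : E → E := fun x => (R / ‖h x‖) • h x
  have hk : ContDiff ℝ 1 k :=
    (contDiff_const.div (hh.norm ℝ hne) fun x => norm_ne_zero_iff.2 (hne x)).smul hh
  have hknorm : ∀ x, ‖k x‖ = R := fun x => by
    have := norm_ne_zero_iff.2 (hne x)
    simp only [k, norm_smul, norm_div, norm_norm, Real.norm_of_nonneg hR.le]
    field_simp
  have hksphere : ∀ x, ‖x‖ = R → k x - x = 0 := fun x hx => by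
    simp only [k, hid x hx.ge, hx, div_self hR.ne', one_smul, sub_self]
  have hkd : ContDiff ℝ 1 fun x => k x - x := hk.sub contDiff_id
  obtain ⟨K, hK⟩ : ∃ K : ℝ≥0, LipschitzOnWith K (fun x => k x - x) (Metric.closedBall 0 R) := by
    obtain ⟨C, hC⟩ := (isCompact_closedBall (0 : E) R).exists_bound_of_continuousOn
      (hkd.continuous_fderiv one_ne_zero).continuousOn
    refine ⟨C.toNNReal, (convex_closedBall (0 : E) R).lipschitzOnWith_of_nnnorm_fderiv_le
      (𝕜 := ℝ) (fun x _ => (hkd.differentiable one_ne_zero) x) fun x hx => ?_⟩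
    rw [← NNReal.coe_le_coe, coe_nnnorm]
    exact (hC x hx).trans (Real.le_coe_toNNReal C)
  have hL := lipschitzWith_indicator_ball hK hksphere
  have hloc : ∀ x ∈ Metric.ball (0 : E) R,
      (Metric.ball (0 : E) R).indicator (fun x => k x - x) =ᶠ[𝓝 x] fun x => k x - x := by
    intro x hx
    filter_upwards [Metric.isOpen_ball.mem_nhds hx] with y hy
    exact indicator_of_mem hy _
  have hmean := integral_det_one_add_fderiv (R := R) hL
    (fun x hx => indicator_of_notMem (by simpa using hx) _)
    (fun x hx => ((hloc x hx).differentiableAt_iff).2 ((hkd.differentiable one_ne_zero) x))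
  have hzero : ∀ x ∈ Metric.ball (0 : E) R,
      (1 + fderiv ℝ ((Metric.ball (0 : E) R).indicator (fun x => k x - x)) x).det = 0 := by
    intro x hx
    have hkx := (hk.differentiable one_ne_zero) x
    have hfd : 1 + fderiv ℝ ((Metric.ball (0 : E) R).indicator (fun x => k x - x)) x =
        fderiv ℝ k x := by
      rw [(hloc x hx).fderiv_eq, fderiv_fun_sub hkx differentiableAt_fun_id]
      have : fderiv ℝ (fun x : E => x) x = 1 := fderiv_fun_id
      rw [this]
      abel
    rw [hfd]
    by_contra hdet
    have hsq : HasFDerivAt (fun y => ‖k y‖ ^ 2) (2 • (innerSL ℝ (k x)).comp (fderiv ℝ k x)) x :=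
      hkx.hasFDerivAt.norm_sq
    have hconst : HasFDerivAt (fun y => ‖k y‖ ^ 2) (0 : E →L[ℝ] ℝ) x := by
      simp_rw [hknorm]
      exact hasFDerivAt_const _ _
    have heq := hsq.unique hconst
    have hsurj : Function.Surjective (fderiv ℝ k x) :=
      (LinearMap.equivOfDetNeZero (fderiv ℝ k x : E →ₗ[ℝ] E) hdet).surjective
    obtain ⟨v, hv⟩ := hsurj (k x)
    have h1 := congrArg (fun L : E →L[ℝ] ℝ => L v) heq
    simp [hv, hknorm] at h1
    exact hR.ne' h1
  rw [setIntegral_congr_fun measurableSet_ball hzero] at hmean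
  simp only [integral_zero] at hmean
  have hpos : 0 < (volume : Measure E).real (Metric.ball (0 : E) R) :=
    ENNReal.toReal_pos (Metric.measure_ball_pos _ _ hR).ne' measure_ball_lt_top.ne
  linarith

/-- **Brouwer's fixed point theorem** for bounded continuous self-maps of a Euclidean space. -/
theorem exists_fixedPoint_of_bounded {g : E → E} (hg : Continuous g) {M : ℝ}
    (hM : ∀ x, ‖g x‖ ≤ M) : ∃ x, g x = x := by
  by_contra! hne
  have hM0 : 0 ≤ M := (norm_nonneg _).trans (hM 0)
  let t : E → Set E := fun y =>
    {v | ‖v - g y‖ < ‖y - g y‖ ∧ (2 * M + 2 ≤ ‖y‖ → v = 0)}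
  have ht : ∀ y, Convex ℝ (t y) := by
    intro y
    have h1 : Convex ℝ {v : E | ‖v - g y‖ < ‖y - g y‖} := by
      have := convex_ball (g y) ‖y - g y‖
      simpa [Metric.ball, dist_eq_norm] using this
    have h2 : Convex ℝ {v : E | 2 * M + 2 ≤ ‖y‖ → v = 0} := by
      by_cases hy : 2 * M + 2 ≤ ‖y‖
      · simp [hy, convex_singleton]
      · simp [hy, convex_univ]
    exact h1.inter h2
  have hloc : ∀ x : E, ∃ c : E, ∀ᶠ y in 𝓝 x, c ∈ t y := by
    intro x
    by_cases hx : 2 * M + 2 ≤ ‖x‖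
    · refine ⟨0, ?_⟩
      filter_upwards [continuous_norm.continuousAt.eventually
        (lt_mem_nhds (show 2 * M < ‖x‖ by linarith))] with y hy
      refine ⟨?_, fun _ => rfl⟩
      have h1 := norm_sub_norm_le y (g y)
      have h2 := hM y
      rw [zero_sub, norm_neg]
      linarith
    · refine ⟨g x, ?_⟩
      have hc1 : Continuous fun y => ‖y - g y‖ - ‖g x - g y‖ := by fun_prop
      have hpos : 0 < ‖x - g x‖ - ‖g x - g x‖ := by
        simpa [sub_eq_zero] using (hne x).symm
      filter_upwards [hc1.continuousAt.eventually (lt_mem_nhds hpos),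
        continuous_norm.continuousAt.eventually (gt_mem_nhds (not_le.1 hx))] with y hy1 hy2
      exact ⟨by linarith, fun hy => absurd hy2 (not_lt.2 hy)⟩
  obtain ⟨G, hG⟩ := exists_contMDiffMap_forall_mem_convex_of_local_const (n := 1) 𝓘(ℝ, E) ht hloc
  have hGd : ContDiff ℝ 1 (fun x => x - G x) := contDiff_id.sub G.contMDiff.contDiff
  obtain ⟨x, hx⟩ := exists_eq_zero_of_eq_id_outside (R := 2 * M + 2) (by linarith) hGd
    (fun x hx => by simp [(hG x).2 hx])
  have h1 := (hG x).1
  rw [← sub_eq_zero.1 hx] at h1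
  exact lt_irrefl _ h1

end Brouwer

/-- **Schauder's fixed point theorem** for continuous self-maps with relatively compact range. -/
theorem exists_fixedPoint_of_range_subset_compact {V : Type*} [NormedAddCommGroup V]
    [NormedSpace ℝ V] {G : V → V} (hG : Continuous G) {K : Set V} (hK : IsCompact K)
    (hGK : ∀ x, G x ∈ K) : ∃ x, G x = x := by
  have happrox : ∀ ε > 0, ∃ x, ‖x - G x‖ ≤ ε := by
    intro ε hε
    obtain ⟨s, -, hsfin, hcover⟩ := hK.finite_cover_balls hε
    have : Fintype s := hsfin.fintype
    let w : s → V → ℝ := fun i y => max 0 (ε - ‖y - i‖)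
    have hw0 : ∀ i y, 0 ≤ w i y := fun i y => le_max_left _ _
    have hwc : ∀ i, Continuous (w i) := fun i => by fun_prop
    let S : V → ℝ := fun y => ∑ i, w i y
    have hS : ∀ x, 0 < S (G x) := by
      intro x
      obtain ⟨i, hi, hxi⟩ := mem_iUnion₂.1 (hcover (hGK x))
      refine Finset.sum_pos' (fun j _ => hw0 j _) ⟨⟨i, hi⟩, Finset.mem_univ _, ?_⟩
      rw [Metric.mem_ball, dist_eq_norm] at hxi
      exact lt_max_of_lt_right (by simpa using hxi)
    let p : EuclideanSpace ℝ s → V := fun c => ∑ i, c i • (i : V)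
    have hp : Continuous p := by fun_prop
    let g : EuclideanSpace ℝ s → EuclideanSpace ℝ s := fun c =>
      WithLp.toLp 2 fun i => w i (G (p c)) / S (G (p c))
    have hg : Continuous g := by
      refine (PiLp.continuous_toLp 2 _).comp (continuous_pi fun i => ?_)
      have hS' : Continuous S := continuous_finsetSum _ fun i _ => hwc i
      exact ((hwc i).comp (hG.comp hp)).div (hS'.comp (hG.comp hp)) fun c => (hS _).ne'
    have hbound : ∀ c, ‖g c‖ ≤ √(Fintype.card s) := by
      intro c
      rw [EuclideanSpace.norm_eq]
      refine Real.sqrt_le_sqrt ?_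
      have : ∀ i, ‖(g c) i‖ ^ 2 ≤ 1 := by
        intro i
        have h1 : (g c) i = w i (G (p c)) / S (G (p c)) := rfl
        have h2 : w i (G (p c)) ≤ S (G (p c)) :=
          Finset.single_le_sum (f := fun j => w j (G (p c))) (fun j _ => hw0 j _)
            (Finset.mem_univ i)
        rw [h1, Real.norm_of_nonneg (div_nonneg (hw0 _ _) (hS _).le)]
        exact pow_le_one₀ (div_nonneg (hw0 _ _) (hS _).le) ((div_le_one (hS _)).2 h2)
      calc ∑ i, ‖(g c) i‖ ^ 2 ≤ ∑ _i : s, (1 : ℝ) := Finset.sum_le_sum fun i _ => this i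
        _ = _ := by simp
    obtain ⟨c, hc⟩ := exists_fixedPoint_of_bounded hg hbound
    refine ⟨p c, ?_⟩
    set y := G (p c) with hy
    have hSy : 0 < S y := hS _
    have hpc : p c = ∑ i, (w i y / S y) • (i : V) := by
      conv_lhs => rw [← hc]
    have hsum : ∑ i, w i y / S y = 1 := by
      rw [← Finset.sum_div, div_self hSy.ne']
    have hdiff : p c - y = ∑ i, (w i y / S y) • ((i : V) - y) := by
      simp_rw [smul_sub, Finset.sum_sub_distrib, ← Finset.sum_smul, hsum, one_smul, hpc]
    rw [hdiff]
    calc ‖∑ i, (w i y / S y) • ((i : V) - y)‖ ≤ ∑ i, ‖(w i y / S y) • ((i : V) - y)‖ :=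
          norm_sum_le _ _
      _ ≤ ∑ i, (w i y / S y) * ε := by
          refine Finset.sum_le_sum fun i _ => ?_
          rw [norm_smul, Real.norm_of_nonneg (div_nonneg (hw0 _ _) hSy.le)]
          by_cases h : ‖(i : V) - y‖ ≤ ε
          · exact mul_le_mul_of_nonneg_left h (div_nonneg (hw0 _ _) hSy.le)
          · have : w i y = 0 := by
              simp only [w]
              rw [max_eq_left]
              rw [norm_sub_rev]
              linarith
            simp [this]
      _ = ε := by rw [← Finset.sum_mul, hsum, one_mul]
  choose x hx using fun n : ℕ => happrox (1 / ((n : ℝ) + 1)) (by positivity)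
  obtain ⟨z, -, θ, hθ, hlim⟩ := hK.tendsto_subseq fun n => hGK (x n)
  have hdiff : Tendsto (fun n => x (θ n) - G (x (θ n))) atTop (nhds 0) :=
    squeeze_zero_norm (fun n => hx (θ n))
      (tendsto_one_div_add_atTop_nhds_zero_nat.comp hθ.tendsto_atTop)
  have hxlim : Tendsto (fun n => x (θ n)) atTop (nhds z) := by
    simpa using hdiff.add hlim
  exact ⟨z, tendsto_nhds_unique ((hG.tendsto z).comp hxlim) hlim⟩

section Operators

variable {T : ℝ}

/-- The continuous extension to the line of a continuous function on `[0,T]`. -/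
def lineExt (hT : 0 ≤ T) (v : C(Icc (0 : ℝ) T, ℝ)) : ℝ → ℝ := IccExtend hT v

theorem continuous_lineExt (hT : 0 ≤ T) (v : C(Icc (0 : ℝ) T, ℝ)) : Continuous (lineExt hT v) :=
  v.continuous.Icc_extend'

theorem lineExt_of_mem (hT : 0 ≤ T) (v : C(Icc (0 : ℝ) T, ℝ)) {t : ℝ} (ht : t ∈ Icc (0 : ℝ) T) :
    lineExt hT v t = v ⟨t, ht⟩ :=
  IccExtend_of_mem hT v ht

theorem abs_lineExt_le (hT : 0 ≤ T) (v : C(Icc (0 : ℝ) T, ℝ)) (t : ℝ) :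
    |lineExt hT v t| ≤ ‖v‖ :=
  v.norm_coe_le_norm _

theorem intervalIntegrable_mul_lineExt (hT : 0 ≤ T) {b : ℝ → ℝ} {s t : ℝ}
    (hb : IntegrableOn b (Icc 0 T)) (v : C(Icc (0 : ℝ) T, ℝ)) (hs : s ∈ Icc 0 T)
    (ht : t ∈ Icc 0 T) :
    IntervalIntegrable (fun τ => b τ * lineExt hT v τ) volume s t := by
  have hb' : IntervalIntegrable b volume s t :=
    (hb.mono_set (uIcc_subset_Icc hs ht)).intervalIntegrable
  exact hb'.mul_continuousOn (continuous_lineExt hT v).continuousOn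

/-- The primitive, vanishing at `0`, of the product of a continuous function with the
weight `b`. -/
def weightedPrimitive (hT : 0 ≤ T) {b : ℝ → ℝ} (hb : IntegrableOn b (Icc 0 T))
    (v : C(Icc (0 : ℝ) T, ℝ)) : C(Icc (0 : ℝ) T, ℝ) where
  toFun t := ∫ τ in (0 : ℝ)..t, b τ * lineExt hT v τ
  continuous_toFun := by
    have h : IntegrableOn (fun τ => b τ * lineExt hT v τ) (Icc 0 T) :=
      (intervalIntegrable_iff_integrableOn_Icc_of_le hT).1
        (intervalIntegrable_mul_lineExt hT hb v (left_mem_Icc.2 hT) (right_mem_Icc.2 hT))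
    exact continuousOn_iff_continuous_domRestrict.1 (intervalIntegral.continuousOn_primitive_interval
      (by rwa [uIcc_of_le hT])) |>.comp (continuous_id.subtype_map (by simp [uIcc_of_le hT]))

theorem norm_weightedPrimitive_sub_le (hT : 0 ≤ T) {b : ℝ → ℝ} (hb : IntegrableOn b (Icc 0 T))
    (v w : C(Icc (0 : ℝ) T, ℝ)) :
    ‖weightedPrimitive hT hb v - weightedPrimitive hT hb w‖ ≤
      (∫ τ in (0 : ℝ)..T, |b τ|) * ‖v - w‖ := by
  have hbi : IntervalIntegrable b volume 0 T :=
    (intervalIntegrable_iff_integrableOn_Icc_of_le hT).2 hb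
  have hnn : 0 ≤ ∫ τ in (0 : ℝ)..T, |b τ| :=
    intervalIntegral.integral_nonneg hT fun _ _ => abs_nonneg _
  refine (ContinuousMap.norm_le _ (by positivity)).2 fun t => ?_
  have h0 : (0 : ℝ) ∈ Icc 0 T := left_mem_Icc.2 hT
  have heq : (weightedPrimitive hT hb v - weightedPrimitive hT hb w) t =
      ∫ τ in (0 : ℝ)..t, b τ * lineExt hT (v - w) τ := by
    change (∫ τ in (0 : ℝ)..t, b τ * lineExt hT v τ) - (∫ τ in (0 : ℝ)..t, b τ * lineExt hT w τ) = _
    rw [← intervalIntegral.integral_sub (intervalIntegrable_mul_lineExt hT hb v h0 t.2)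
      (intervalIntegrable_mul_lineExt hT hb w h0 t.2)]
    refine intervalIntegral.integral_congr fun τ _ => ?_
    simp only [lineExt, IccExtend, Function.comp, ContinuousMap.coe_sub, Pi.sub_apply]
    ring
  rw [heq]
  calc ‖∫ τ in (0 : ℝ)..t, b τ * lineExt hT (v - w) τ‖
      ≤ ∫ τ in (0 : ℝ)..t, |b τ| * ‖v - w‖ := by
        refine intervalIntegral.norm_integral_le_of_norm_le t.2.1
          (Eventually.of_forall fun τ _ => ?_)
          ((hbi.abs.mono_set (uIcc_subset_uIcc_left (by simp [uIcc_of_le hT]))).mul_const _)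
        rw [Real.norm_eq_abs, abs_mul]
        exact mul_le_mul_of_nonneg_left (abs_lineExt_le hT _ τ) (abs_nonneg _)
    _ = (∫ τ in (0 : ℝ)..t, |b τ|) * ‖v - w‖ := intervalIntegral.integral_mul_const _ _
    _ ≤ (∫ τ in (0 : ℝ)..T, |b τ|) * ‖v - w‖ := by
        refine mul_le_mul_of_nonneg_right ?_ (norm_nonneg _)
        exact intervalIntegral.integral_mono_interval le_rfl t.2.1 t.2.2
          (Eventually.of_forall fun _ => abs_nonneg _) hbi.abs

theorem continuous_weightedPrimitive (hT : 0 ≤ T) {b : ℝ → ℝ} (hb : IntegrableOn b (Icc 0 T)) :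
    Continuous (weightedPrimitive hT hb) := by
  refine (LipschitzWith.of_dist_le_mul (K := (∫ τ in (0 : ℝ)..T, |b τ|).toNNReal)
    fun v w => ?_).continuous
  rw [dist_eq_norm, dist_eq_norm, Real.coe_toNNReal _
    (intervalIntegral.integral_nonneg hT fun _ _ => abs_nonneg _)]
  exact norm_weightedPrimitive_sub_le hT hb v w

theorem norm_weightedPrimitive_le (hT : 0 ≤ T) {b : ℝ → ℝ} (hb : IntegrableOn b (Icc 0 T))
    (v : C(Icc (0 : ℝ) T, ℝ)) :
    ‖weightedPrimitive hT hb v‖ ≤ (∫ τ in (0 : ℝ)..T, |b τ|) * ‖v‖ := by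
  have h0 : weightedPrimitive hT hb 0 = 0 := by
    ext t
    simp [weightedPrimitive, lineExt, IccExtend]
  simpa [h0] using norm_weightedPrimitive_sub_le hT hb v 0

/-- The maximum of a continuous function on `[0,T]`. -/
def maxValue (v : C(Icc (0 : ℝ) T, ℝ)) : ℝ := ⨆ t, v t

theorem le_maxValue (v : C(Icc (0 : ℝ) T, ℝ)) (t : Icc (0 : ℝ) T) : v t ≤ maxValue v :=
  le_ciSup (isCompact_range v.continuous).bddAbove t

theorem exists_eq_maxValue (hT : 0 ≤ T) (v : C(Icc (0 : ℝ) T, ℝ)) : ∃ t, v t = maxValue v := by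
  have : Nonempty (Icc (0 : ℝ) T) := ⟨⟨0, left_mem_Icc.2 hT⟩⟩
  obtain ⟨t, -, ht⟩ := isCompact_univ.exists_isMaxOn univ_nonempty v.continuous.continuousOn
  exact ⟨t, le_antisymm (le_maxValue v t) (ciSup_le fun s => ht (mem_univ s))⟩

theorem maxValue_add_const (hT : 0 ≤ T) (v : C(Icc (0 : ℝ) T, ℝ)) (c : ℝ) :
    maxValue (v + ContinuousMap.const _ c) = maxValue v + c := by
  obtain ⟨t, ht⟩ := exists_eq_maxValue hT v
  obtain ⟨s, hs⟩ := exists_eq_maxValue hT (v + ContinuousMap.const _ c)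
  refine le_antisymm ?_ ?_
  · rw [← hs]
    simpa using le_maxValue v s
  · rw [← ht]
    exact le_maxValue (v + ContinuousMap.const _ c) t

theorem continuous_maxValue (hT : 0 ≤ T) :
    Continuous (maxValue : C(Icc (0 : ℝ) T, ℝ) → ℝ) := by
  refine (LipschitzWith.of_le_add fun v w => ?_).continuous
  obtain ⟨t, ht⟩ := exists_eq_maxValue hT v
  have h1 := le_maxValue w t
  have h2 := ContinuousMap.dist_apply_le_dist (f := v) (g := w) t
  rw [Real.dist_eq] at h2
  have h3 := le_abs_self (v t - w t)
  linarith

/-- The set of `M`-Lipschitz functions bounded by `M` is compact. -/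
theorem isCompact_lipschitz_bounded (M : ℝ) :
    IsCompact {v : C(Icc (0 : ℝ) T, ℝ) |
      (∀ t, |v t| ≤ M) ∧ ∀ s t, |v s - v t| ≤ M * dist s t} := by
  rcases lt_or_ge M 0 with hM | hM
  · rcases isEmpty_or_nonempty (Icc (0 : ℝ) T) with h | ⟨⟨t⟩⟩
    · exact (Set.subsingleton_of_subsingleton).isCompact
    · convert isCompact_empty
      rw [eq_empty_iff_forall_notMem]
      rintro v ⟨h, -⟩
      linarith [abs_nonneg (v t), h t]
  refine ArzelaAscoli.isCompact_of_equicontinuous _ ?_ ?_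
  · have himg : ContinuousMap.toFun '' {v : C(Icc (0 : ℝ) T, ℝ) |
        (∀ t, |v t| ≤ M) ∧ ∀ s t, |v s - v t| ≤ M * dist s t} =
        (Set.pi univ fun _ => Icc (-M) M) ∩ {f | ∀ s t, |f s - f t| ≤ M * dist s t} := by
      ext f
      constructor
      · rintro ⟨v, ⟨h1, h2⟩, rfl⟩
        exact ⟨fun t _ => abs_le.1 (h1 t), h2⟩
      · rintro ⟨h1, h2⟩
        have hc : Continuous f := (LipschitzWith.of_dist_le_mul (K := M.toNNReal) fun s t => by
          rw [Real.coe_toNNReal M hM, Real.dist_eq]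
          exact h2 s t).continuous
        exact ⟨⟨f, hc⟩, ⟨fun t => abs_le.2 (h1 t (mem_univ t)), h2⟩, rfl⟩
    rw [himg]
    refine (isCompact_univ_pi fun _ => isCompact_Icc).inter_right ?_
    simp only [ofPred_forall]
    refine isClosed_iInter fun s => isClosed_iInter fun t => isClosed_le ?_ continuous_const
    fun_prop
  · refine Metric.equicontinuous_of_continuity_modulus (fun r => M * r) ?_ _ fun s t v => ?_
    · exact (continuous_const.mul continuous_id).tendsto' 0 0 (by simp)
    · rw [Real.dist_eq]
      exact v.2.2 s t

end Operators

section Balance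

variable {T : ℝ}

theorem exists_balance (hT : 0 < T) (φ : ℝ ≃o ℝ) (hφ : φ 0 = 0) (p : C(Icc (0 : ℝ) T, ℝ)) :
    ∃ κ : ℝ, |κ| ≤ ‖p‖ ∧ ∫ τ in (0 : ℝ)..T, φ.symm (κ - lineExt hT.le p τ) = 0 := by
  have hφ' : φ.symm 0 = 0 := by rw [← hφ, φ.symm_apply_apply, hφ]
  have hcont : Continuous fun κ : ℝ => ∫ τ in (0 : ℝ)..T, φ.symm (κ - lineExt hT.le p τ) := by
    refine intervalIntegral.continuous_parametric_intervalIntegral_of_continuous' ?_ 0 T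
    have := continuous_lineExt hT.le p
    exact φ.symm.continuous.comp (by fun_prop)
  have hb := fun τ => abs_le.1 (abs_lineExt_le hT.le p τ)
  have hlow : ∫ τ in (0 : ℝ)..T, φ.symm (-‖p‖ - lineExt hT.le p τ) ≤ 0 := by
    rw [← neg_nonneg, ← intervalIntegral.integral_neg]
    refine intervalIntegral.integral_nonneg hT.le fun τ _ => neg_nonneg.2 ?_
    exact (φ.symm.monotone (by linarith [(hb τ).1])).trans_eq hφ'
  have hhigh : 0 ≤ ∫ τ in (0 : ℝ)..T, φ.symm (‖p‖ - lineExt hT.le p τ) := by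
    refine intervalIntegral.integral_nonneg hT.le fun τ _ => ?_
    exact hφ'.symm.le.trans (φ.symm.monotone (by linarith [(hb τ).2]))
  obtain ⟨κ, hκ, hκ0⟩ := intermediate_value_Icc (a := -‖p‖) (b := ‖p‖)
    (by linarith [norm_nonneg p]) hcont.continuousOn ⟨hlow, hhigh⟩
  exact ⟨κ, abs_le.2 hκ, hκ0⟩

theorem balance_le_of_integral_eq_zero (hT : 0 < T) (φ : ℝ ≃o ℝ) {p r : C(Icc (0 : ℝ) T, ℝ)}
    {κ ρ : ℝ} (hκ : ∫ τ in (0 : ℝ)..T, φ.symm (κ - lineExt hT.le p τ) = 0)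
    (hρ : ∫ τ in (0 : ℝ)..T, φ.symm (ρ - lineExt hT.le r τ) = 0) : κ ≤ ρ + ‖p - r‖ := by
  by_contra! hlt
  have hp := continuous_lineExt hT.le p
  have hr := continuous_lineExt hT.le r
  have hpt : ∀ τ, φ.symm (ρ - lineExt hT.le r τ) < φ.symm (κ - lineExt hT.le p τ) := by
    intro τ
    refine φ.symm.strictMono ?_
    have h1 := abs_le.1 (abs_lineExt_le hT.le (p - r) τ)
    have h2 : lineExt hT.le (p - r) τ = lineExt hT.le p τ - lineExt hT.le r τ := rfl
    rw [h2] at h1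
    linarith [h1.2]
  have := intervalIntegral.integral_lt_integral_of_continuousOn_of_le_of_exists_lt hT
    (f := fun τ => φ.symm (ρ - lineExt hT.le r τ)) (g := fun τ => φ.symm (κ - lineExt hT.le p τ))
    (φ.symm.continuous.comp (by fun_prop)).continuousOn
    (φ.symm.continuous.comp (by fun_prop)).continuousOn
    (fun τ _ => (hpt τ).le) ⟨0, left_mem_Icc.2 hT.le, hpt 0⟩
  rw [hκ, hρ] at this
  exact lt_irrefl _ this

/-- The unique constant `κ` such that `φ⁻¹(κ - p)` has zero mean. -/
def balance (hT : 0 < T) (φ : ℝ ≃o ℝ) (hφ : φ 0 = 0) (p : C(Icc (0 : ℝ) T, ℝ)) : ℝ :=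
  (exists_balance hT φ hφ p).choose

theorem abs_balance_le (hT : 0 < T) (φ : ℝ ≃o ℝ) (hφ : φ 0 = 0) (p : C(Icc (0 : ℝ) T, ℝ)) :
    |balance hT φ hφ p| ≤ ‖p‖ :=
  (exists_balance hT φ hφ p).choose_spec.1

theorem integral_balance (hT : 0 < T) (φ : ℝ ≃o ℝ) (hφ : φ 0 = 0) (p : C(Icc (0 : ℝ) T, ℝ)) :
    ∫ τ in (0 : ℝ)..T, φ.symm (balance hT φ hφ p - lineExt hT.le p τ) = 0 :=
  (exists_balance hT φ hφ p).choose_spec.2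

theorem eq_balance (hT : 0 < T) (φ : ℝ ≃o ℝ) (hφ : φ 0 = 0) {p : C(Icc (0 : ℝ) T, ℝ)} {κ : ℝ}
    (hκ : ∫ τ in (0 : ℝ)..T, φ.symm (κ - lineExt hT.le p τ) = 0) : κ = balance hT φ hφ p := by
  have h := integral_balance hT φ hφ p
  exact le_antisymm (by simpa using balance_le_of_integral_eq_zero hT φ hκ h)
    (by simpa using balance_le_of_integral_eq_zero hT φ h hκ)

theorem continuous_balance (hT : 0 < T) (φ : ℝ ≃o ℝ) (hφ : φ 0 = 0) :
    Continuous (balance hT φ hφ) :=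
  (LipschitzWith.of_le_add fun p r => by
    rw [dist_eq_norm]
    exact balance_le_of_integral_eq_zero hT φ (integral_balance hT φ hφ p)
      (integral_balance hT φ hφ r)).continuous

end Balance

/-- `u`, with derivative `u'`, is a `T`-periodic solution of
`(φ(u') + F(u))' + a(t) q(u) = σ + e(t)` in integrated form. -/
structure IsPeriodicSol (T : ℝ) (φ : ℝ ≃o ℝ) (a e F q : ℝ → ℝ) (σ : ℝ) (u u' : ℝ → ℝ) :
    Prop where
  hasDeriv : ∀ t ∈ Icc (0 : ℝ) T, HasDerivWithinAt u (u' t) (Icc (0 : ℝ) T) t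
  continuousOn_deriv : ContinuousOn u' (Icc (0 : ℝ) T)
  periodic : u 0 = u T
  periodic_deriv : u' 0 = u' T
  equation : ∀ t ∈ Icc (0 : ℝ) T, φ (u' t) + F (u t) =
    φ (u' 0) + F (u 0) + ∫ τ in (0 : ℝ)..t, (σ + e τ - a τ * q (u τ))

/-- The data of a periodic problem `(φ(u') + F(u))' + a(t) q(u) = σ + e(t)` in which the mean
`σ` is free. -/
structure LienardData where
  /-- the period -/
  T : ℝ
  /-- the nonlinear differential operator -/
  φ : ℝ ≃o ℝ
  /-- the weight -/
  a : ℝ → ℝ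
  /-- the forcing term -/
  e : ℝ → ℝ
  /-- the primitive of the friction coefficient -/
  F : C(ℝ, ℝ)
  /-- the restoring force -/
  q : C(ℝ, ℝ)
  T_pos : 0 < T
  φ_zero : φ 0 = 0
  integrable_a : IntegrableOn a (Icc 0 T)
  integrable_e : IntegrableOn e (Icc 0 T)
  integral_e : ∫ t in (0 : ℝ)..T, e t = 0
  bounded_F : ∃ C, ∀ x, |F x| ≤ C
  bounded_q : ∃ C, ∀ x, |q x| ≤ C

namespace LienardData

variable (d : LienardData)

/-- Continuous functions on the period interval. -/
abbrev Space : Type := C(Icc (0 : ℝ) d.T, ℝ)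

theorem zero_mem : (0 : ℝ) ∈ Icc (0 : ℝ) d.T := left_mem_Icc.2 d.T_pos.le

theorem end_mem : d.T ∈ Icc (0 : ℝ) d.T := right_mem_Icc.2 d.T_pos.le

/-- The mean of `a q(u)`. -/
def meanForce (u : d.Space) : ℝ :=
  d.T⁻¹ * weightedPrimitive d.T_pos.le d.integrable_a (d.q.comp u) ⟨d.T, d.end_mem⟩

/-- The function `F(u) + ∫ (a q(u) - σ - e)`, where `σ` is the mean of `a q(u)`. -/
def load (u : d.Space) : d.Space :=
  d.F.comp u + weightedPrimitive d.T_pos.le d.integrable_a (d.q.comp u)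
    - d.meanForce u • ⟨fun t => (t : ℝ), continuous_subtype_val⟩
    - weightedPrimitive d.T_pos.le d.integrable_e (ContinuousMap.const _ 1)

/-- The derivative assigned to `u` by the fixed point operator. -/
def slope (u : d.Space) : d.Space :=
  (⟨d.φ.symm, d.φ.symm.continuous⟩ : C(ℝ, ℝ)).comp
    (ContinuousMap.const _ (balance d.T_pos d.φ d.φ_zero (d.load u)) - d.load u)

/-- The primitive of `slope`, vanishing at both end points. -/
def shape (u : d.Space) : d.Space :=
  weightedPrimitive (b := fun _ => 1) d.T_pos.le (integrableOn_const (by simp)) (d.slope u)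

theorem continuous_meanForce : Continuous d.meanForce :=
  continuous_const.mul ((continuous_eval_const _).comp
    ((continuous_weightedPrimitive _ _).comp (ContinuousMap.continuous_postcomp _)))

theorem continuous_load : Continuous d.load :=
  (((ContinuousMap.continuous_postcomp _).add
    ((continuous_weightedPrimitive _ _).comp (ContinuousMap.continuous_postcomp _))).sub
      (d.continuous_meanForce.smul continuous_const)).sub continuous_const

theorem continuous_slope : Continuous d.slope := by
  refine (ContinuousMap.continuous_postcomp _).comp (Continuous.sub ?_ d.continuous_load)
  exact ContinuousMap.continuous_const'.comp
    ((continuous_balance d.T_pos d.φ d.φ_zero).comp d.continuous_load)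

theorem continuous_shape : Continuous d.shape :=
  (continuous_weightedPrimitive _ _).comp d.continuous_slope

theorem lineExt_slope (u : d.Space) (t : ℝ) : lineExt d.T_pos.le (d.slope u) t =
    d.φ.symm (balance d.T_pos d.φ d.φ_zero (d.load u) - lineExt d.T_pos.le (d.load u) t) :=
  rfl

theorem shape_apply (u : d.Space) (t : Icc (0 : ℝ) d.T) :
    d.shape u t = ∫ τ in (0 : ℝ)..t, lineExt d.T_pos.le (d.slope u) τ := by
  simp [shape, weightedPrimitive]

theorem load_apply (u : d.Space) (t : Icc (0 : ℝ) d.T) :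
    d.load u t = d.F (u t) -
      ∫ τ in (0 : ℝ)..t, (d.meanForce u + d.e τ - d.a τ * d.q (lineExt d.T_pos.le u τ)) := by
  have h1 := intervalIntegrable_mul_lineExt d.T_pos.le d.integrable_a (d.q.comp u) d.zero_mem t.2
  have h2 := intervalIntegrable_mul_lineExt d.T_pos.le d.integrable_e
    (ContinuousMap.const _ 1) d.zero_mem t.2
  have h3 : ∀ τ, lineExt d.T_pos.le (ContinuousMap.const _ 1) τ = 1 := fun τ => rfl
  have h4 : ∀ τ, lineExt d.T_pos.le (d.q.comp u) τ = d.q (lineExt d.T_pos.le u τ) := fun τ => rfl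
  simp only [h3, h4, mul_one] at h1 h2
  rw [intervalIntegral.integral_sub (intervalIntegrable_const.add h2) h1,
    intervalIntegral.integral_add intervalIntegrable_const h2, intervalIntegral.integral_const]
  simp only [load, weightedPrimitive, ContinuousMap.sub_apply, ContinuousMap.add_apply,
    ContinuousMap.smul_apply, ContinuousMap.coe_mk, h3, h4, mul_one, smul_eq_mul,
    ContinuousMap.comp_apply, sub_zero]
  ring

theorem integral_defect (u : d.Space) : ∫ τ in (0 : ℝ)..d.T,
    (d.meanForce u + d.e τ - d.a τ * d.q (lineExt d.T_pos.le u τ)) = 0 := by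
  have h1 := intervalIntegrable_mul_lineExt d.T_pos.le d.integrable_a (d.q.comp u) d.zero_mem
    d.end_mem
  have h2 : IntervalIntegrable d.e volume 0 d.T :=
    (intervalIntegrable_iff_integrableOn_Icc_of_le d.T_pos.le).2 d.integrable_e
  have h4 : ∀ τ, lineExt d.T_pos.le (d.q.comp u) τ = d.q (lineExt d.T_pos.le u τ) := fun τ => rfl
  simp only [h4] at h1
  rw [intervalIntegral.integral_sub (intervalIntegrable_const.add h2) h1,
    intervalIntegral.integral_add intervalIntegrable_const h2, intervalIntegral.integral_const,
    d.integral_e]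
  have hT := d.T_pos.ne'
  simp only [meanForce, weightedPrimitive, ContinuousMap.coe_mk, h4, smul_eq_mul]
  field_simp
  ring

/-- Functions that coincide with their shape up to a constant are periodic solutions. -/
theorem isPeriodicSol_of_eq_shape_add {u : d.Space} {c : ℝ}
    (hu : u = d.shape u + ContinuousMap.const _ c) :
    IsPeriodicSol d.T d.φ d.a d.e d.F d.q (d.meanForce u) (lineExt d.T_pos.le u)
      (lineExt d.T_pos.le (d.slope u)) := by
  have hval : ∀ t ∈ Icc (0 : ℝ) d.T, lineExt d.T_pos.le u t =
      (∫ τ in (0 : ℝ)..t, lineExt d.T_pos.le (d.slope u) τ) + c := by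
    intro t ht
    rw [lineExt_of_mem _ _ ht]
    conv_lhs => rw [hu]
    rw [ContinuousMap.add_apply, d.shape_apply]
    rfl
  have hcs := continuous_lineExt d.T_pos.le (d.slope u)
  have hper : lineExt d.T_pos.le u 0 = lineExt d.T_pos.le u d.T := by
    rw [hval 0 d.zero_mem, hval d.T d.end_mem]
    simp only [lineExt_slope, integral_balance, intervalIntegral.integral_same]
  have heq : ∀ t ∈ Icc (0 : ℝ) d.T, d.φ (lineExt d.T_pos.le (d.slope u) t) +
      d.F (lineExt d.T_pos.le u t) = balance d.T_pos d.φ d.φ_zero (d.load u) +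
      ∫ τ in (0 : ℝ)..t, (d.meanForce u + d.e τ - d.a τ * d.q (lineExt d.T_pos.le u τ)) := by
    intro t ht
    rw [lineExt_slope, OrderIso.apply_symm_apply, lineExt_of_mem _ _ ht, load_apply,
      lineExt_of_mem _ u ht]
    ring
  have h0 := heq 0 d.zero_mem
  simp only [intervalIntegral.integral_same, add_zero] at h0
  refine ⟨fun t ht => ?_, hcs.continuousOn, hper, ?_, fun t ht => ?_⟩
  · have hd : HasDerivAt (fun t => (∫ τ in (0 : ℝ)..t, lineExt d.T_pos.le (d.slope u) τ) + c)
        (lineExt d.T_pos.le (d.slope u) t) t :=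
      (intervalIntegral.integral_hasDerivAt_right (hcs.intervalIntegrable _ _)
        (hcs.stronglyMeasurableAtFilter _ _) hcs.continuousAt).add_const c
    exact hd.hasDerivWithinAt.congr hval (hval t ht)
  · have hTT := heq d.T d.end_mem
    rw [integral_defect, add_zero, ← hper] at hTT
    exact d.φ.injective (by linarith)
  · rw [heq t ht, h0]

/-- Periodic solutions coincide with their shape up to a constant. -/
theorem eq_shape_add_of_isPeriodicSol {σ : ℝ} {u u' : ℝ → ℝ}
    (hu : IsPeriodicSol d.T d.φ d.a d.e d.F d.q σ u u') :
    ∃ v : d.Space, (∀ t : Icc (0 : ℝ) d.T, v t = u t) ∧ d.meanForce v = σ ∧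
      v = d.shape v + ContinuousMap.const _ (u 0) := by
  have hcu : ContinuousOn u (Icc 0 d.T) := fun t ht => (hu.hasDeriv t ht).continuousWithinAt
  let v : d.Space := ⟨fun t => u t, hcu.domRestrict⟩
  have hv : ∀ t ∈ Icc (0 : ℝ) d.T, lineExt d.T_pos.le v t = u t := fun t ht =>
    lineExt_of_mem _ _ ht
  have hcongr : ∀ (c : ℝ), ∀ t ∈ Icc (0 : ℝ) d.T, ∫ τ in (0 : ℝ)..t,
      (c + d.e τ - d.a τ * d.q (lineExt d.T_pos.le v τ)) =
      ∫ τ in (0 : ℝ)..t, (c + d.e τ - d.a τ * d.q (u τ)) := by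
    intro c t ht
    refine intervalIntegral.integral_congr fun τ hτ => ?_
    rw [uIcc_of_le ht.1] at hτ
    simp only [hv τ ⟨hτ.1, hτ.2.trans ht.2⟩]
  have hσ : d.meanForce v = σ := by
    have h1 := d.integral_defect v
    have h2 := hu.equation d.T d.end_mem
    rw [← hu.periodic, ← hu.periodic_deriv, ← hcongr σ d.T d.end_mem] at h2
    have h3 : ∫ τ in (0 : ℝ)..d.T,
        (σ + d.e τ - d.a τ * d.q (lineExt d.T_pos.le v τ)) = 0 := by linarith
    have hi : ∀ c : ℝ, IntervalIntegrable
        (fun τ => c + d.e τ - d.a τ * d.q (lineExt d.T_pos.le v τ)) volume 0 d.T := fun c =>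
      (intervalIntegrable_const.add
        ((intervalIntegrable_iff_integrableOn_Icc_of_le d.T_pos.le).2 d.integrable_e)).sub
        (intervalIntegrable_mul_lineExt d.T_pos.le d.integrable_a (d.q.comp v) d.zero_mem d.end_mem)
    have h4 := intervalIntegral.integral_sub (hi (d.meanForce v)) (hi σ)
    have h5 : ∀ τ, d.meanForce v + d.e τ - d.a τ * d.q (lineExt d.T_pos.le v τ) -
      (σ + d.e τ - d.a τ * d.q (lineExt d.T_pos.le v τ)) = d.meanForce v - σ := fun τ => by ring
    simp only [h5, h1, h3, sub_zero, intervalIntegral.integral_const, smul_eq_mul] at h4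
    rcases mul_eq_zero.1 h4 with h | h
    · exact absurd h d.T_pos.ne'
    · linarith
  have hload : ∀ t ∈ Icc (0 : ℝ) d.T,
      lineExt d.T_pos.le (d.load v) t = d.φ (u' 0) + d.F (u 0) - d.φ (u' t) := by
    intro t ht
    rw [lineExt_of_mem _ _ ht, load_apply, hσ]
    have h1 := hu.equation t ht
    rw [← hcongr σ t ht] at h1
    change d.F (u t) - _ = _
    simp only
    linarith
  have hftc : ∀ t ∈ Icc (0 : ℝ) d.T, ∫ τ in (0 : ℝ)..t, u' τ = u t - u 0 := by
    intro t ht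
    refine intervalIntegral.integral_eq_sub_of_hasDeriv_right_of_le ht.1
      (hcu.mono (Icc_subset_Icc_right ht.2)) (fun x hx => ?_)
      ((hu.continuousOn_deriv.mono (Icc_subset_Icc_right ht.2)).intervalIntegrable_of_Icc ht.1)
    exact ((hu.hasDeriv x ⟨hx.1.le, hx.2.le.trans ht.2⟩).hasDerivAt
      (Icc_mem_nhds hx.1 (hx.2.trans_le ht.2))).hasDerivWithinAt
  have hprim : ∀ t ∈ Icc (0 : ℝ) d.T, ∫ τ in (0 : ℝ)..t,
      d.φ.symm (d.φ (u' 0) + d.F (u 0) - lineExt d.T_pos.le (d.load v) τ) = u t - u 0 := by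
    intro t ht
    rw [← hftc t ht]
    refine intervalIntegral.integral_congr fun τ hτ => ?_
    rw [uIcc_of_le ht.1] at hτ
    simp only [hload τ ⟨hτ.1, hτ.2.trans ht.2⟩, sub_sub_cancel, OrderIso.symm_apply_apply]
  have hbal : d.φ (u' 0) + d.F (u 0) = balance d.T_pos d.φ d.φ_zero (d.load v) := by
    refine eq_balance d.T_pos d.φ d.φ_zero ?_
    rw [hprim d.T d.end_mem, hu.periodic, sub_self]
  refine ⟨v, fun t => rfl, hσ, ?_⟩
  ext t
  rw [ContinuousMap.add_apply, shape_apply]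
  simp only [lineExt_slope, ← hbal, hprim t t.2, ContinuousMap.const_apply]
  change u t = _
  ring

/-- The range of `shape` consists of uniformly Lipschitz functions. -/
theorem exists_shape_bound : ∃ M : ℝ, 0 ≤ M ∧ ∀ u : d.Space,
    (∀ t, |d.shape u t| ≤ M) ∧ ∀ s t, |d.shape u s - d.shape u t| ≤ M * dist s t := by
  obtain ⟨CF, hCF⟩ := d.bounded_F
  obtain ⟨Cq, hCq⟩ := d.bounded_q
  have hCF0 : 0 ≤ CF := (abs_nonneg _).trans (hCF 0)
  have hCq0 : 0 ≤ Cq := (abs_nonneg _).trans (hCq 0)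
  set A := ∫ τ in (0 : ℝ)..d.T, |d.a τ| with hA
  have hA0 : 0 ≤ A := intervalIntegral.integral_nonneg d.T_pos.le fun _ _ => abs_nonneg _
  set Z := ‖weightedPrimitive d.T_pos.le d.integrable_e (ContinuousMap.const _ 1)‖ with hZ
  set P := CF + A * Cq + A * Cq + Z with hP
  have hP0 : 0 ≤ P := by positivity
  have hload : ∀ u, ‖d.load u‖ ≤ P := by
    intro u
    have h1 : ‖d.F.comp u‖ ≤ CF := (ContinuousMap.norm_le _ hCF0).2 fun t => hCF _
    have h2 : ‖weightedPrimitive d.T_pos.le d.integrable_a (d.q.comp u)‖ ≤ A * Cq :=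
      (norm_weightedPrimitive_le _ _ _).trans (mul_le_mul_of_nonneg_left
        ((ContinuousMap.norm_le _ hCq0).2 fun t => hCq _) hA0)
    have h3 : ‖d.meanForce u • (⟨fun t => (t : ℝ), continuous_subtype_val⟩ : d.Space)‖
        ≤ A * Cq := by
      refine (ContinuousMap.norm_le _ (by positivity)).2 fun t => ?_
      have h4 := (ContinuousMap.norm_coe_le_norm (weightedPrimitive d.T_pos.le d.integrable_a
        (d.q.comp u)) ⟨d.T, d.end_mem⟩).trans h2
      rw [ContinuousMap.smul_apply, ContinuousMap.coe_mk, smul_eq_mul, meanForce, norm_mul,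
        norm_mul, norm_inv, Real.norm_of_nonneg d.T_pos.le, Real.norm_of_nonneg t.2.1]
      have hT := d.T_pos
      have h5 : (t : ℝ) / d.T ≤ 1 := (div_le_one hT).2 t.2.2
      calc _ = ((t : ℝ) / d.T) * ‖weightedPrimitive d.T_pos.le d.integrable_a (d.q.comp u)
              ⟨d.T, d.end_mem⟩‖ := by ring
        _ ≤ 1 * (A * Cq) := mul_le_mul h5 h4 (norm_nonneg _) zero_le_one
        _ = A * Cq := one_mul _
    exact (norm_sub_le _ _).trans (add_le_add ((norm_sub_le _ _).trans
      (add_le_add ((norm_add_le _ _).trans (add_le_add h1 h2)) h3)) le_rfl)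
  set B := max |d.φ.symm (-(2 * P))| |d.φ.symm (2 * P)| with hB
  have hslope : ∀ u t, |lineExt d.T_pos.le (d.slope u) t| ≤ B := by
    intro u t
    rw [lineExt_slope]
    have h1 := abs_le.1 ((abs_balance_le d.T_pos d.φ d.φ_zero (d.load u)).trans (hload u))
    have h2 := abs_le.1 ((abs_lineExt_le d.T_pos.le (d.load u) t).trans (hload u))
    exact abs_le_max_abs_abs (d.φ.symm.monotone (by linarith [h1.1, h2.2]))
      (d.φ.symm.monotone (by linarith [h1.2, h2.1]))
  have hB0 : 0 ≤ B := (abs_nonneg _).trans (le_max_left _ _)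
  have hsub : ∀ u s t, |d.shape u s - d.shape u t| ≤ B * |(s : ℝ) - t| := by
    intro u s t
    have hcs := continuous_lineExt d.T_pos.le (d.slope u)
    rw [shape_apply, shape_apply, intervalIntegral.integral_interval_sub_left
      (hcs.intervalIntegrable _ _) (hcs.intervalIntegrable _ _), ← Real.norm_eq_abs]
    exact intervalIntegral.norm_integral_le_of_norm_le_const fun τ _ => hslope u τ
  have hT := d.T_pos
  refine ⟨B * (d.T + 1), by positivity, fun u => ⟨fun t => ?_, fun s t => ?_⟩⟩
  · have h1 := hsub u t ⟨0, d.zero_mem⟩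
    have h2 : d.shape u ⟨0, d.zero_mem⟩ = 0 := by simp [shape_apply]
    rw [h2, sub_zero, sub_zero, abs_of_nonneg t.2.1] at h1
    exact h1.trans (mul_le_mul_of_nonneg_left (by linarith [t.2.2]) hB0)
  · refine (hsub u s t).trans ?_
    rw [Subtype.dist_eq, Real.dist_eq]
    exact mul_le_mul_of_nonneg_right (le_mul_of_one_le_right hB0 (by linarith)) (abs_nonneg _)

/-- Existence of a periodic solution whose highest position relative to `β` lies in a prescribed
interval and is stationary under a clamped feedback of the defect `σ - s`. -/
theorem exists_sol_with_feedback (β : d.Space) {c₀ c₁ : ℝ} (hc : c₀ ≤ c₁) (s ε : ℝ) :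
    ∃ (v : d.Space) (σ m : ℝ) (u' : ℝ → ℝ),
      IsPeriodicSol d.T d.φ d.a d.e d.F d.q σ (lineExt d.T_pos.le v) u' ∧
      (∀ t, v t ≤ β t + m) ∧ (∃ t, v t = β t + m) ∧ m ∈ Icc c₀ c₁ ∧
      m = max c₀ (min c₁ (m + ε * (σ - s))) := by
  obtain ⟨M, hM0, hM⟩ := d.exists_shape_bound
  let κ : d.Space → ℝ := fun u =>
    max c₀ (min c₁ (maxValue (u - β) + ε * (d.meanForce u - s))) - maxValue (d.shape u - β)
  have hmax := continuous_maxValue d.T_pos.le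
  have hκ : Continuous κ := by
    have h1 := d.continuous_meanForce
    have h2 : Continuous fun u : d.Space => maxValue (u - β) :=
      hmax.comp (continuous_id.sub continuous_const)
    have h3 : Continuous fun u : d.Space => maxValue (d.shape u - β) :=
      hmax.comp (d.continuous_shape.sub continuous_const)
    fun_prop
  let G : d.Space → d.Space := fun u => d.shape u + ContinuousMap.const _ (κ u)
  have hG : Continuous G := d.continuous_shape.add (ContinuousMap.continuous_const'.comp hκ)
  have hGmax : ∀ u, maxValue (G u - β) =
      max c₀ (min c₁ (maxValue (u - β) + ε * (d.meanForce u - s))) := by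
    intro u
    have h1 : G u - β = (d.shape u - β) + ContinuousMap.const _ (κ u) := by
      simp only [G]
      abel
    rw [h1, maxValue_add_const d.T_pos.le]
    simp only [κ]
    ring
  have hκb : ∀ u, |κ u| ≤ max |c₀| |c₁| + (M + ‖β‖) := by
    intro u
    have h1 : |max c₀ (min c₁ (maxValue (u - β) + ε * (d.meanForce u - s)))| ≤ max |c₀| |c₁| :=
      abs_le_max_abs_abs (le_max_left _ _) (max_le hc (min_le_left _ _))
    have h2 : |maxValue (d.shape u - β)| ≤ M + ‖β‖ := by
      obtain ⟨t, ht⟩ := exists_eq_maxValue d.T_pos.le (d.shape u - β)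
      rw [← ht]
      exact (abs_sub _ _).trans (add_le_add ((hM u).1 t) (β.norm_coe_le_norm t))
    exact (abs_sub _ _).trans (add_le_add h1 h2)
  obtain ⟨v, hv⟩ := exists_fixedPoint_of_range_subset_compact hG
    (isCompact_lipschitz_bounded (T := d.T) (M + (max |c₀| |c₁| + (M + ‖β‖)))) fun u => by
      have h0 : 0 ≤ max |c₀| |c₁| + (M + ‖β‖) := by positivity
      refine ⟨fun t => ?_, fun s t => ?_⟩
      · exact (abs_add_le _ _).trans (add_le_add ((hM u).1 t) (hκb u))
      · have h1 : G u s - G u t = d.shape u s - d.shape u t := by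
          simp [G]
        rw [h1]
        exact ((hM u).2 s t).trans
          (mul_le_mul_of_nonneg_right (le_add_of_nonneg_right h0) dist_nonneg)
  have hm := hGmax v
  rw [hv] at hm
  refine ⟨v, d.meanForce v, maxValue (v - β), _,
    d.isPeriodicSol_of_eq_shape_add (c := κ v) hv.symm, fun t => ?_, ?_, ?_, hm⟩
  · have := le_maxValue (v - β) t
    rw [ContinuousMap.sub_apply] at this
    linarith
  · obtain ⟨t, ht⟩ := exists_eq_maxValue d.T_pos.le (v - β)
    refine ⟨t, ?_⟩
    rw [← ht, ContinuousMap.sub_apply]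
    ring
  · rw [hm]
    exact ⟨le_max_left _ _, max_le hc (min_le_left _ _)⟩

/-- Among the periodic solutions bounded by `L` there is one with the least mean `σ`. -/
theorem exists_sol_with_least_mean {L σ₁ : ℝ} {u₁ u₁' : ℝ → ℝ}
    (h₁ : IsPeriodicSol d.T d.φ d.a d.e d.F d.q σ₁ u₁ u₁')
    (hL : ∀ t ∈ Icc (0 : ℝ) d.T, |u₁ t| ≤ L) :
    ∃ (v : d.Space) (σ₀ : ℝ) (v' : ℝ → ℝ), (∀ t, |v t| ≤ L) ∧
      IsPeriodicSol d.T d.φ d.a d.e d.F d.q σ₀ (lineExt d.T_pos.le v) v' ∧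
      ∀ (σ : ℝ) (u u' : ℝ → ℝ), IsPeriodicSol d.T d.φ d.a d.e d.F d.q σ u u' →
        (∀ t ∈ Icc (0 : ℝ) d.T, |u t| ≤ L) → σ₀ ≤ σ := by
  obtain ⟨M, hM0, hM⟩ := d.exists_shape_bound
  have hL0 : 0 ≤ L := (abs_nonneg _).trans (hL 0 d.zero_mem)
  let S : Set d.Space := {v | (∀ t, |v t| ≤ L) ∧
    v = d.shape v + ContinuousMap.const _ (v ⟨0, d.zero_mem⟩)}
  have hclosed : IsClosed S := by
    refine IsClosed.inter ?_ (isClosed_eq continuous_id (d.continuous_shape.add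
      (ContinuousMap.continuous_const'.comp (continuous_eval_const _))))
    have : {v : d.Space | ∀ t, |v t| ≤ L} = ⋂ t, {v : d.Space | |v t| ≤ L} := by
      ext v
      simp
    change IsClosed {v : d.Space | ∀ t, |v t| ≤ L}
    rw [this]
    exact isClosed_iInter fun t => isClosed_le (continuous_eval_const t).abs continuous_const
  have hS : IsCompact S := by
    refine (isCompact_lipschitz_bounded (T := d.T) (M + L)).of_isClosed_subset hclosed ?_
    rintro v ⟨hv1, hv2⟩
    refine ⟨fun t => (hv1 t).trans (by linarith), fun s t => ?_⟩
    have h1 : v s - v t = d.shape v s - d.shape v t := by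
      have hs := congrArg (fun w : d.Space => w s) hv2
      have ht := congrArg (fun w : d.Space => w t) hv2
      simp only [ContinuousMap.add_apply, ContinuousMap.const_apply] at hs ht
      linarith
    rw [h1]
    exact ((hM v).2 s t).trans
      (mul_le_mul_of_nonneg_right (le_add_of_nonneg_right hL0) dist_nonneg)
  have hmem : ∀ (σ : ℝ) (u u' : ℝ → ℝ), IsPeriodicSol d.T d.φ d.a d.e d.F d.q σ u u' →
      (∀ t ∈ Icc (0 : ℝ) d.T, |u t| ≤ L) → ∃ v ∈ S, d.meanForce v = σ := by
    intro σ u u' hu huL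
    obtain ⟨v, hv1, hv2, hv3⟩ := d.eq_shape_add_of_isPeriodicSol hu
    refine ⟨v, ⟨fun t => by rw [hv1]; exact huL t t.2, ?_⟩, hv2⟩
    rw [hv1]
    exact hv3
  obtain ⟨v₁, hv₁, -⟩ := hmem _ _ _ h₁ hL
  obtain ⟨v, hv, hmin⟩ := hS.exists_isMinOn ⟨v₁, hv₁⟩ d.continuous_meanForce.continuousOn
  refine ⟨v, d.meanForce v, _, hv.1, d.isPeriodicSol_of_eq_shape_add hv.2,
    fun σ u u' hu huL => ?_⟩
  obtain ⟨w, hw, rfl⟩ := hmem σ u u' hu huL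
  exact hmin hw

end LienardData

/-- Integration by parts of an indefinite integral against a `C¹` function. -/
theorem integral_primitive_mul_deriv {T : ℝ} (hT : 0 ≤ T) {h u u' : ℝ → ℝ}
    (hh : IntervalIntegrable h volume 0 T)
    (hu : ∀ t ∈ Icc (0 : ℝ) T, HasDerivWithinAt u (u' t) (Icc (0 : ℝ) T) t)
    (hu' : ContinuousOn u' (Icc (0 : ℝ) T)) :
    ∫ t in (0 : ℝ)..T, (∫ τ in (0 : ℝ)..t, h τ) * u' t =
      (∫ τ in (0 : ℝ)..T, h τ) * u T - ∫ t in (0 : ℝ)..T, h t * u t := by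
  have hacu : AbsolutelyContinuousOnInterval u 0 T := by
    obtain ⟨C, hC⟩ := isCompact_Icc.exists_bound_of_continuousOn hu'
    have hlip : LipschitzOnWith C.toNNReal u (Icc 0 T) :=
      (convex_Icc 0 T).lipschitzOnWith_of_nnnorm_hasDerivWithin_le hu fun t ht => by
        rw [← NNReal.coe_le_coe, coe_nnnorm]
        exact (hC t ht).trans (Real.le_coe_toNNReal C)
    rw [← uIcc_of_le hT] at hlip
    exact hlip.absolutelyContinuousOnInterval
  have hparts := (hh.absolutelyContinuousOnInterval_intervalIntegral
    (left_mem_uIcc)).integral_mul_deriv_eq_deriv_mul hacu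
  have hleft : ∫ t in (0 : ℝ)..T, (∫ τ in (0 : ℝ)..t, h τ) * u' t =
      ∫ t in (0 : ℝ)..T, (∫ τ in (0 : ℝ)..t, h τ) * deriv u t := by
    refine intervalIntegral.integral_congr_Ioo_of_le hT fun t ht => ?_
    rw [((hu t (Ioo_subset_Icc_self ht)).hasDerivAt (Icc_mem_nhds ht.1 ht.2)).deriv]
  have hright : ∫ t in (0 : ℝ)..T, deriv (fun t => ∫ τ in (0 : ℝ)..t, h τ) t * u t =
      ∫ t in (0 : ℝ)..T, h t * u t := by
    refine intervalIntegral.integral_congr_ae ?_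
    filter_upwards [hh.ae_hasDerivAt_integral] with t ht htT
    rw [(ht (uIoc_subset_uIcc htT) 0 left_mem_uIcc).deriv]
  rw [hleft, hparts, hright]
  simp

theorem OrderIso.exists_coercivity_bound (φ : ℝ ≃o ℝ) (hφ : φ 0 = 0) {A : ℝ} (hA : 0 ≤ A) :
    ∃ B, 0 ≤ B ∧ ∀ x, A * |x| ≤ φ x * x + B := by
  have hpos : 0 ≤ φ.symm A := by
    rw [← φ.le_iff_le, φ.apply_symm_apply, hφ]; exact hA
  have hneg : φ.symm (-A) ≤ 0 := by
    rw [← φ.le_iff_le, φ.apply_symm_apply, hφ]; linarith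
  refine ⟨A * (φ.symm A - φ.symm (-A)), mul_nonneg hA (by linarith), fun x => ?_⟩
  rcases le_total 0 x with hx | hx
  · rw [abs_of_nonneg hx]
    have h0 : 0 ≤ φ x := by rw [← hφ]; exact φ.monotone hx
    rcases le_total (φ.symm A) x with h | h
    · have h1 : A ≤ φ x := by rw [← φ.apply_symm_apply A]; exact φ.monotone h
      nlinarith [mul_nonneg hA (by linarith : 0 ≤ φ.symm A - φ.symm (-A))]
    · nlinarith [mul_nonneg h0 hx]
  · rw [abs_of_nonpos hx]
    have h0 : φ x ≤ 0 := by rw [← hφ]; exact φ.monotone hx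
    rcases le_total x (φ.symm (-A)) with h | h
    · have h1 : φ x ≤ -A := by rw [← φ.apply_symm_apply (-A)]; exact φ.monotone h
      nlinarith [mul_nonneg hA (by linarith : 0 ≤ φ.symm A - φ.symm (-A))]
    · nlinarith [mul_nonneg_of_nonpos_of_nonpos h0 hx]

/-- The standing assumptions on the weight `a` and the forcing term `e`. -/
structure IsAdmissible (T : ℝ) (φ : ℝ ≃o ℝ) (a e : ℝ → ℝ) : Prop where
  T_pos : 0 < T
  φ_zero : φ 0 = 0
  integrable_a : IntegrableOn a (Icc 0 T)
  integrable_e : IntegrableOn e (Icc 0 T)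
  bounded_a : ∃ C, ∀ᵐ t ∂(volume.restrict (Icc 0 T)), |a t| ≤ C
  nonneg_a : ∀ᵐ t ∂(volume.restrict (Icc 0 T)), 0 ≤ a t
  integral_a : ∫ t in (0 : ℝ)..T, a t = T
  integral_e : ∫ t in (0 : ℝ)..T, e t = 0

namespace IsAdmissible

variable {T : ℝ} {φ : ℝ ≃o ℝ} {a e : ℝ → ℝ}

theorem intervalIntegrable_a (hd : IsAdmissible T φ a e) : IntervalIntegrable a volume 0 T :=
  (intervalIntegrable_iff_integrableOn_Icc_of_le hd.T_pos.le).2 hd.integrable_a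

theorem intervalIntegrable_e (hd : IsAdmissible T φ a e) : IntervalIntegrable e volume 0 T :=
  (intervalIntegrable_iff_integrableOn_Icc_of_le hd.T_pos.le).2 hd.integrable_e

end IsAdmissible

namespace IsPeriodicSol

variable {T : ℝ} {φ : ℝ ≃o ℝ} {a e F q : ℝ → ℝ} {σ : ℝ} {u u' : ℝ → ℝ}

theorem continuousOn (hu : IsPeriodicSol T φ a e F q σ u u') : ContinuousOn u (Icc 0 T) :=
  fun t ht => (hu.hasDeriv t ht).continuousWithinAt

theorem intervalIntegrable_a_mul (hu : IsPeriodicSol T φ a e F q σ u u')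
    (hd : IsAdmissible T φ a e) (hq : Continuous q) :
    IntervalIntegrable (fun t => a t * q (u t)) volume 0 T :=
  hd.intervalIntegrable_a.mul_continuousOn
    (by rw [uIcc_of_le hd.T_pos.le]; exact hq.comp_continuousOn hu.continuousOn)

theorem intervalIntegrable_force (hu : IsPeriodicSol T φ a e F q σ u u')
    (hd : IsAdmissible T φ a e) (hq : Continuous q) :
    IntervalIntegrable (fun t => σ + e t - a t * q (u t)) volume 0 T :=
  (intervalIntegrable_const.add hd.intervalIntegrable_e).sub (hu.intervalIntegrable_a_mul hd hq)

theorem integral_force (hu : IsPeriodicSol T φ a e F q σ u u') (hd : IsAdmissible T φ a e) :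
    ∫ t in (0 : ℝ)..T, (σ + e t - a t * q (u t)) = 0 := by
  have h := hu.equation T (right_mem_Icc.2 hd.T_pos.le)
  rw [← hu.periodic, ← hu.periodic_deriv] at h
  linarith

theorem mean_mul_eq (hu : IsPeriodicSol T φ a e F q σ u u') (hd : IsAdmissible T φ a e)
    (hq : Continuous q) : T * σ = ∫ t in (0 : ℝ)..T, a t * q (u t) := by
  have h := hu.integral_force hd
  rw [intervalIntegral.integral_sub (intervalIntegrable_const.add hd.intervalIntegrable_e)
    (hu.intervalIntegrable_a_mul hd hq), intervalIntegral.integral_add intervalIntegrable_const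
    hd.intervalIntegrable_e, hd.integral_e] at h
  simp only [intervalIntegral.integral_const, smul_eq_mul] at h
  linarith

theorem le_mean (hu : IsPeriodicSol T φ a e F q σ u u') (hd : IsAdmissible T φ a e)
    (hq : Continuous q) {ρ : ℝ} (hρ : ∀ t ∈ Icc (0 : ℝ) T, ρ ≤ q (u t)) : ρ ≤ σ := by
  have h : ∫ t in (0 : ℝ)..T, a t * ρ ≤ ∫ t in (0 : ℝ)..T, a t * q (u t) := by
    refine intervalIntegral.integral_mono_ae_restrict hd.T_pos.le
      (hd.intervalIntegrable_a.mul_const ρ) (hu.intervalIntegrable_a_mul hd hq) ?_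
    filter_upwards [hd.nonneg_a, ae_restrict_mem measurableSet_Icc] with t h0 ht
    exact mul_le_mul_of_nonneg_left (hρ t ht) h0
  rw [← hu.mean_mul_eq hd hq, intervalIntegral.integral_mul_const, hd.integral_a] at h
  exact le_of_mul_le_mul_left h hd.T_pos

theorem mean_le (hu : IsPeriodicSol T φ a e F q σ u u') (hd : IsAdmissible T φ a e)
    (hq : Continuous q) {ρ : ℝ} (hρ : ∀ t ∈ Icc (0 : ℝ) T, q (u t) ≤ ρ) : σ ≤ ρ := by
  have h : ∫ t in (0 : ℝ)..T, a t * q (u t) ≤ ∫ t in (0 : ℝ)..T, a t * ρ := by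
    refine intervalIntegral.integral_mono_ae_restrict hd.T_pos.le
      (hu.intervalIntegrable_a_mul hd hq) (hd.intervalIntegrable_a.mul_const ρ) ?_
    filter_upwards [hd.nonneg_a, ae_restrict_mem measurableSet_Icc] with t h0 ht
    exact mul_le_mul_of_nonneg_left (hρ t ht) h0
  rw [← hu.mean_mul_eq hd hq, intervalIntegral.integral_mul_const, hd.integral_a] at h
  exact le_of_mul_le_mul_left h hd.T_pos

theorem intervalIntegrable_deriv (hu : IsPeriodicSol T φ a e F q σ u u') {s t : ℝ}
    (hs : s ∈ Icc (0 : ℝ) T) (ht : t ∈ Icc (0 : ℝ) T) : IntervalIntegrable u' volume s t :=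
  (hu.continuousOn_deriv.mono (uIcc_subset_Icc hs ht)).intervalIntegrable

theorem integral_deriv (hu : IsPeriodicSol T φ a e F q σ u u') {s t : ℝ}
    (hs : s ∈ Icc (0 : ℝ) T) (ht : t ∈ Icc (0 : ℝ) T) : ∫ τ in s..t, u' τ = u t - u s := by
  have hsub := uIcc_subset_Icc hs ht
  refine intervalIntegral.integral_eq_sub_of_hasDeriv_right (hu.continuousOn.mono hsub)
    (fun x hx => ?_) (hu.intervalIntegrable_deriv hs ht)
  refine ((hu.hasDeriv x (hsub (Ioo_subset_Icc_self hx))).hasDerivAt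
    (Icc_mem_nhds ?_ ?_)).hasDerivWithinAt
  · exact (le_min hs.1 ht.1).trans_lt hx.1
  · exact hx.2.trans_le (max_le hs.2 ht.2)

theorem sub_le_integral_abs_deriv (hu : IsPeriodicSol T φ a e F q σ u u') {s t : ℝ}
    (hs : s ∈ Icc (0 : ℝ) T) (ht : t ∈ Icc (0 : ℝ) T) :
    u t - u s ≤ ∫ τ in (0 : ℝ)..T, |u' τ| := by
  have h0T : (0 : ℝ) ≤ T := hs.1.trans hs.2
  have hintegrable : IntervalIntegrable (fun τ => |u' τ|) volume 0 T :=
    (hu.intervalIntegrable_deriv (left_mem_Icc.2 h0T) (right_mem_Icc.2 h0T)).abs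
  rw [← hu.integral_deriv hs ht]
  refine (Real.le_norm_self _).trans ((intervalIntegral.norm_integral_le_integral_norm_uIoc).trans ?_)
  rw [intervalIntegral.integral_of_le h0T]
  refine setIntegral_mono_set hintegrable.1 (ae_of_all _ fun τ => abs_nonneg _) ?_
  exact LE.le.eventuallyLE (Ioc_subset_Ioc (le_min hs.1 ht.1) (max_le hs.2 ht.2))

/-- Testing the equation against `u`. -/
theorem integral_mul_deriv_eq (hu : IsPeriodicSol T φ a e F q σ u u')
    (hd : IsAdmissible T φ a e) (hF : Continuous F) (hq : Continuous q) (M : ℝ) :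
    ∫ t in (0 : ℝ)..T, φ (u' t) * u' t =
      ∫ t in (0 : ℝ)..T, (σ + e t - a t * q (u t)) * (M - u t) := by
  have hT := hd.T_pos.le
  have hcu := hu.continuousOn
  have hcu' := hu.continuousOn_deriv
  have hforce := hu.intervalIntegrable_force hd hq
  have hFu : ∫ t in (0 : ℝ)..T, F (u t) * u' t = 0 := by
    have h := intervalIntegral.integral_comp_mul_deriv'' (f := u) (f' := u') (g := F) (a := 0)
      (b := T) (by rwa [uIcc_of_le hT]) (fun x hx => ?_) (by rwa [uIcc_of_le hT])
      hF.continuousOn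
    · simpa [← hu.periodic] using h
    · rw [min_eq_left hT, max_eq_right hT] at hx
      exact ((hu.hasDeriv x (Ioo_subset_Icc_self hx)).hasDerivAt
        (Icc_mem_nhds hx.1 hx.2)).hasDerivWithinAt
  have hIu' : IntervalIntegrable u' volume 0 T :=
    hu.intervalIntegrable_deriv (left_mem_Icc.2 hT) (right_mem_Icc.2 hT)
  have hφu : IntervalIntegrable (fun t => φ (u' t) * u' t) volume 0 T :=
    ContinuousOn.intervalIntegrable (by
      rw [uIcc_of_le hT]; exact (φ.continuous.comp_continuousOn hcu').mul hcu')
  have hFI : IntervalIntegrable (fun t => F (u t) * u' t) volume 0 T :=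
    ContinuousOn.intervalIntegrable (by
      rw [uIcc_of_le hT]; exact (hF.comp_continuousOn hcu).mul hcu')
  have hparts := integral_primitive_mul_deriv hT hforce hu.hasDeriv hcu'
  rw [hu.integral_force hd, zero_mul, zero_sub] at hparts
  have hrhs : ∫ t in (0 : ℝ)..T, (σ + e t - a t * q (u t)) * (M - u t) =
      -∫ t in (0 : ℝ)..T, (σ + e t - a t * q (u t)) * u t := by
    have hI : IntervalIntegrable (fun t => (σ + e t - a t * q (u t)) * u t) volume 0 T :=
      hforce.mul_continuousOn (by rwa [uIcc_of_le hT])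
    simp_rw [mul_sub]
    rw [intervalIntegral.integral_sub (hforce.mul_const M) hI,
      intervalIntegral.integral_mul_const, hu.integral_force hd]
    ring
  rw [hrhs, ← hparts]
  have hsum : ∫ t in (0 : ℝ)..T, (∫ τ in (0 : ℝ)..t, (σ + e τ - a τ * q (u τ))) * u' t =
      ∫ t in (0 : ℝ)..T, (φ (u' t) * u' t + F (u t) * u' t -
        (φ (u' 0) + F (u 0)) * u' t) := by
    refine intervalIntegral.integral_congr fun t ht => ?_
    rw [uIcc_of_le hT] at ht
    have := hu.equation t ht
    change (∫ τ in (0 : ℝ)..t, (σ + e τ - a τ * q (u τ))) * u' t = _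
    rw [show ∫ τ in (0 : ℝ)..t, (σ + e τ - a τ * q (u τ)) =
      φ (u' t) + F (u t) - (φ (u' 0) + F (u 0)) by linarith]
    ring
  rw [hsum, intervalIntegral.integral_sub (hφu.add hFI) (hIu'.const_mul _),
    intervalIntegral.integral_add hφu hFI, hFu, intervalIntegral.integral_const_mul,
    hu.integral_deriv (left_mem_Icc.2 hT) (right_mem_Icc.2 hT), hu.periodic]
  ring

end IsPeriodicSol

/-- The oscillation of periodic solutions is bounded in terms of an upper bound of the mean and
a lower bound of the restoring force only. -/
theorem IsAdmissible.exists_oscillation_bound {T : ℝ} {φ : ℝ ≃o ℝ} {a e : ℝ → ℝ}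
    (hd : IsAdmissible T φ a e) (S q₀ : ℝ) :
    ∃ B, 0 ≤ B ∧ ∀ (F q : ℝ → ℝ) (σ : ℝ) (u u' : ℝ → ℝ), Continuous F → Continuous q →
      (∀ x, -q₀ ≤ q x) → σ ≤ S → IsPeriodicSol T φ a e F q σ u u' →
      ∀ s ∈ Icc (0 : ℝ) T, ∀ t ∈ Icc (0 : ℝ) T, u t - u s ≤ B := by
  have hT := hd.T_pos.le
  have hDI : IntervalIntegrable (fun t => |S| + |e t| + a t * |q₀|) volume 0 T :=
    (intervalIntegrable_const.add hd.intervalIntegrable_e.abs).add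
      (hd.intervalIntegrable_a.mul_const _)
  set D := ∫ t in (0 : ℝ)..T, (|S| + |e t| + a t * |q₀|) with hD
  have hD0 : 0 ≤ D := by
    refine intervalIntegral.integral_nonneg_of_ae_restrict hT ?_
    filter_upwards [hd.nonneg_a] with t ht
    have := mul_nonneg ht (abs_nonneg q₀)
    change 0 ≤ |S| + |e t| + a t * |q₀|
    positivity
  obtain ⟨B, hB0, hB⟩ := φ.exists_coercivity_bound hd.φ_zero (by linarith : 0 ≤ D + 1)
  refine ⟨B * T, mul_nonneg hB0 hT, fun F q σ u u' hF hq hq₀ hσ hu s hs t ht => ?_⟩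
  obtain ⟨tM, htM, hmax⟩ := isCompact_Icc.exists_isMaxOn ⟨s, hs⟩ hu.continuousOn
  set J := ∫ τ in (0 : ℝ)..T, |u' τ| with hJ
  have hcu' := hu.continuousOn_deriv
  have hM : ∀ τ ∈ Icc (0 : ℝ) T, 0 ≤ u tM - u τ ∧ u tM - u τ ≤ J := fun τ hτ =>
    ⟨sub_nonneg.2 (hmax hτ), hu.sub_le_integral_abs_deriv hτ htM⟩
  have hupper : ∫ τ in (0 : ℝ)..T, φ (u' τ) * u' τ ≤ D * J := by
    rw [hu.integral_mul_deriv_eq hd hF hq (u tM), hD, ← intervalIntegral.integral_mul_const]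
    refine intervalIntegral.integral_mono_ae_restrict hT
      ((hu.intervalIntegrable_force hd hq).mul_continuousOn ?_) (hDI.mul_const J) ?_
    · rw [uIcc_of_le hT]
      exact continuousOn_const.sub hu.continuousOn
    · filter_upwards [hd.nonneg_a, ae_restrict_mem measurableSet_Icc] with τ h0 hτ
      have h1 : -(a τ * q (u τ)) ≤ a τ * |q₀| := by
        rw [← mul_neg]
        exact mul_le_mul_of_nonneg_left (by linarith [hq₀ (u τ), le_abs_self q₀]) h0
      have h2 : σ + e τ - a τ * q (u τ) ≤ |S| + |e τ| + a τ * |q₀| := by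
        linarith [le_abs_self S, le_abs_self (e τ)]
      have h3 : 0 ≤ |S| + |e τ| + a τ * |q₀| := by
        have := mul_nonneg h0 (abs_nonneg q₀)
        positivity
      exact (mul_le_mul_of_nonneg_right h2 (hM τ hτ).1).trans
        (mul_le_mul_of_nonneg_left (hM τ hτ).2 h3)
  have hJI : IntervalIntegrable (fun τ => |u' τ|) volume 0 T :=
    (hu.intervalIntegrable_deriv (left_mem_Icc.2 hT) (right_mem_Icc.2 hT)).abs
  have hφu : IntervalIntegrable (fun t => φ (u' t) * u' t) volume 0 T :=
    ContinuousOn.intervalIntegrable (by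
      rw [uIcc_of_le hT]; exact (φ.continuous.comp_continuousOn hcu').mul hcu')
  have hlower : (D + 1) * J ≤ (∫ τ in (0 : ℝ)..T, φ (u' τ) * u' τ) + B * T := by
    have h := intervalIntegral.integral_mono_on hT (hJI.const_mul (D + 1))
      (hφu.add (intervalIntegrable_const (c := B))) fun τ _ => hB (u' τ)
    rw [intervalIntegral.integral_const_mul, intervalIntegral.integral_add hφu
      intervalIntegrable_const, intervalIntegral.integral_const] at h
    simpa [mul_comm] using h
  linarith [hu.sub_le_integral_abs_deriv hs ht]

theorem HasDerivWithinAt.nonneg_of_nonneg_of_right {g : ℝ → ℝ} {g' t₀ T : ℝ} (ht : t₀ < T)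
    (hg : HasDerivWithinAt g g' (Icc t₀ T) t₀) (h0 : g t₀ = 0)
    (hpos : ∀ t ∈ Icc t₀ T, 0 ≤ g t) : 0 ≤ g' := by
  have h := (hg.mono Ioc_subset_Icc_self)
  rw [hasDerivWithinAt_iff_tendsto_slope' (by simp)] at h
  have : (nhdsWithin t₀ (Ioc t₀ T)).NeBot := left_nhdsWithin_Ioc_neBot ht
  refine ge_of_tendsto h ?_
  filter_upwards [self_mem_nhdsWithin] with t ht
  rw [slope_def_field, h0, sub_zero]
  exact div_nonneg (hpos t (Ioc_subset_Icc_self ht)) (sub_nonneg.2 ht.1.le)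

theorem HasDerivWithinAt.nonpos_of_nonneg_of_left {g : ℝ → ℝ} {g' t₀ S : ℝ} (ht : S < t₀)
    (hg : HasDerivWithinAt g g' (Icc S t₀) t₀) (h0 : g t₀ = 0)
    (hpos : ∀ t ∈ Icc S t₀, 0 ≤ g t) : g' ≤ 0 := by
  have h := (hg.mono Ico_subset_Icc_self)
  rw [hasDerivWithinAt_iff_tendsto_slope' (by simp)] at h
  have : (nhdsWithin t₀ (Ico S t₀)).NeBot := right_nhdsWithin_Ico_neBot ht
  refine le_of_tendsto h ?_
  filter_upwards [self_mem_nhdsWithin] with t ht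
  rw [slope_def_field, h0, sub_zero]
  exact div_nonpos_of_nonneg_of_nonpos (hpos t (Ico_subset_Icc_self ht)) (sub_nonpos.2 ht.2.le)

namespace IsPeriodicSol

variable {T : ℝ} {φ : ℝ ≃o ℝ} {a e F q : ℝ → ℝ} {σ s : ℝ} {u u' β β' : ℝ → ℝ}

/-- Ordered solutions which touch have the same derivative at the contact point. -/
theorem deriv_eq_of_touching (hT : 0 < T) (hu : IsPeriodicSol T φ a e F q σ u u')
    (hβ : IsPeriodicSol T φ a e F q s β β') (hle : ∀ t ∈ Icc (0 : ℝ) T, u t ≤ β t)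
    {t₀ : ℝ} (ht₀ : t₀ ∈ Ico (0 : ℝ) T) (heq : u t₀ = β t₀) : u' t₀ = β' t₀ := by
  have hg : ∀ t ∈ Icc (0 : ℝ) T, HasDerivWithinAt (fun t => β t - u t) (β' t - u' t)
      (Icc 0 T) t := fun t ht => (hβ.hasDeriv t ht).sub (hu.hasDeriv t ht)
  have hmem : t₀ ∈ Icc (0 : ℝ) T := Ico_subset_Icc_self ht₀
  have hright : 0 ≤ β' t₀ - u' t₀ := by
    refine ((hg t₀ hmem).mono (Icc_subset_Icc_left ht₀.1)).nonneg_of_nonneg_of_right ht₀.2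
      (by simp [heq]) fun t ht => sub_nonneg.2 (hle t ⟨ht₀.1.trans ht.1, ht.2⟩)
  have hleft : β' t₀ - u' t₀ ≤ 0 := by
    rcases ht₀.1.eq_or_lt with h0 | h0
    · subst h0
      rw [hβ.periodic_deriv, hu.periodic_deriv]
      exact (hg T (right_mem_Icc.2 hT.le)).nonpos_of_nonneg_of_left hT
        (by simp [← hu.periodic, ← hβ.periodic, heq]) fun t ht => sub_nonneg.2 (hle t ht)
    · exact ((hg t₀ hmem).mono (Icc_subset_Icc_right ht₀.2.le)).nonpos_of_nonneg_of_left h0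
        (by simp [heq]) fun t ht => sub_nonneg.2 (hle t ⟨ht.1, ht.2.trans ht₀.2.le⟩)
  linarith

/-- A solution with larger mean cannot touch a solution with smaller mean from below. -/
theorem not_touching (hd : IsAdmissible T φ a e) (hq : Continuous q)
    (hu : IsPeriodicSol T φ a e F q σ u u') (hβ : IsPeriodicSol T φ a e F q s β β')
    (hsσ : s < σ) (hle : ∀ t ∈ Icc (0 : ℝ) T, u t ≤ β t)
    (hF : ∀ t ∈ Icc (0 : ℝ) T, DifferentiableAt ℝ F (β t)) :
    ∀ t ∈ Icc (0 : ℝ) T, u t ≠ β t := by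
  suffices H : ∀ t ∈ Ico (0 : ℝ) T, u t ≠ β t by
    intro t ht
    rcases ht.2.eq_or_lt with h | h
    · rw [h, ← hu.periodic, ← hβ.periodic]
      exact H 0 ⟨le_rfl, hd.T_pos⟩
    · exact H t ⟨ht.1, h⟩
  intro t₀ ht₀ heq
  have hmem : t₀ ∈ Icc (0 : ℝ) T := Ico_subset_Icc_self ht₀
  have hderiv := deriv_eq_of_touching hd.T_pos hu hβ hle ht₀ heq
  obtain ⟨C, hC⟩ := hd.bounded_a
  have hδ : 0 < σ - s := sub_pos.2 hsσ
  have hC1 : 0 < |C| + 1 := by positivity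
  -- near the contact point the restoring forces are close
  have hqclose : ∀ᶠ t in nhdsWithin t₀ (Icc 0 T),
      |q (u t) - q (β t)| < (σ - s) / (2 * (|C| + 1)) := by
    have hc : ContinuousWithinAt (fun t => |q (u t) - q (β t)|) (Icc 0 T) t₀ :=
      (((hq.comp_continuousOn hu.continuousOn).sub
        (hq.comp_continuousOn hβ.continuousOn)).abs) t₀ hmem
    refine hc.eventually_lt_const ?_
    simp only [heq, sub_self, abs_zero]
    positivity
  -- and the friction terms differ by a small multiple of the elapsed time
  have hFclose : ∀ᶠ t in nhdsWithin t₀ (Icc 0 T),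
      |F (u t) - F (β t)| ≤ (σ - s) / 4 * |t - t₀| := by
    have hFd := (hF t₀ hmem).hasDerivAt
    have h1 := hFd.comp_hasDerivWithinAt t₀ (hβ.hasDeriv t₀ hmem)
    rw [← heq] at hFd
    have h2 := hFd.comp_hasDerivWithinAt t₀ (hu.hasDeriv t₀ hmem)
    have h3 := h2.sub h1
    rw [heq, hderiv, sub_self] at h3
    have h4 := h3.isLittleO.def (by linarith : 0 < (σ - s) / 4)
    filter_upwards [h4] with t ht
    simpa [heq] using ht
  obtain ⟨r, hr, hball⟩ := Metric.mem_nhdsWithin_iff.1 (hqclose.and hFclose)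
  obtain ⟨η, hη, hη'⟩ := exists_between (lt_min (sub_pos.2 ht₀.2) hr)
  have hηT := hη'.trans_le (min_le_left _ _)
  have hηr := hη'.trans_le (min_le_right _ _)
  have hsub : ∀ t ∈ Icc t₀ (t₀ + η), t ∈ Icc (0 : ℝ) T := fun t ht =>
    ⟨ht₀.1.trans ht.1, by linarith [ht.2]⟩
  have hnear : ∀ t ∈ Icc t₀ (t₀ + η), |q (u t) - q (β t)| < (σ - s) / (2 * (|C| + 1)) ∧
      |F (u t) - F (β t)| ≤ (σ - s) / 4 * |t - t₀| := fun t ht => by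
    refine hball ⟨?_, hsub t ht⟩
    rw [Metric.mem_ball, Real.dist_eq, abs_of_nonneg (sub_nonneg.2 ht.1)]
    linarith [ht.2]
  have hfu := hu.intervalIntegrable_force hd hq
  have hfβ := hβ.intervalIntegrable_force hd hq
  have hgrow : ∀ t ∈ Ioo t₀ (t₀ + η), β' t < u' t := by
    intro t ht
    have htI := Ioo_subset_Icc_self ht
    have htT := hsub t htI
    have hs1 : uIcc 0 t ⊆ uIcc 0 T := by
      rw [uIcc_of_le htT.1, uIcc_of_le hd.T_pos.le]; exact Icc_subset_Icc_right htT.2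
    have hs2 : uIcc 0 t₀ ⊆ uIcc 0 T := by
      rw [uIcc_of_le ht₀.1, uIcc_of_le hd.T_pos.le]; exact Icc_subset_Icc_right ht₀.2.le
    have hs3 : uIcc t₀ t ⊆ uIcc 0 T := by
      rw [uIcc_of_le ht.1.le, uIcc_of_le hd.T_pos.le]; exact Icc_subset_Icc ht₀.1 htT.2
    have hincu := intervalIntegral.integral_interval_sub_left (hfu.mono_set hs1)
      (hfu.mono_set hs2)
    have hincβ := intervalIntegral.integral_interval_sub_left (hfβ.mono_set hs1)
      (hfβ.mono_set hs2)
    have hlow : (σ - s) / 2 * (t - t₀) ≤ ∫ τ in t₀..t,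
        ((σ + e τ - a τ * q (u τ)) - (s + e τ - a τ * q (β τ))) := by
      have hconst : ∫ _ in t₀..t, (σ - s) / 2 = (σ - s) / 2 * (t - t₀) := by
        rw [intervalIntegral.integral_const, smul_eq_mul, mul_comm]
      rw [← hconst]
      refine intervalIntegral.integral_mono_ae_restrict ht.1.le intervalIntegrable_const
        ((hfu.mono_set hs3).sub (hfβ.mono_set hs3)) ?_
      have hsubset : Icc t₀ t ⊆ Icc 0 T := Icc_subset_Icc ht₀.1 htT.2
      filter_upwards [ae_restrict_of_ae_restrict_of_subset hsubset hC,
        ae_restrict_mem measurableSet_Icc] with τ hτC hτ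
      have h1 := (hnear τ ⟨hτ.1, hτ.2.trans ht.2.le⟩).1
      have h2 : |a τ * (q (u τ) - q (β τ))| ≤ (σ - s) / 2 := by
        rw [abs_mul]
        calc |a τ| * |q (u τ) - q (β τ)|
            ≤ (|C| + 1) * ((σ - s) / (2 * (|C| + 1))) :=
              mul_le_mul (by linarith [le_abs_self C]) h1.le (abs_nonneg _) hC1.le
          _ = (σ - s) / 2 := by field_simp
      have h3 := (abs_le.1 h2).2
      rw [mul_sub] at h3
      linarith
    rw [intervalIntegral.integral_sub (hfu.mono_set hs3) (hfβ.mono_set hs3)] at hlow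
    have hFt := (abs_le.1 (hnear t htI).2).2
    rw [abs_of_pos (sub_pos.2 ht.1)] at hFt
    have e1 := hu.equation t htT
    have e2 := hu.equation t₀ hmem
    have e3 := hβ.equation t htT
    have e4 := hβ.equation t₀ hmem
    rw [hderiv, heq] at e2
    rw [← φ.lt_iff_lt]
    have hprod := mul_pos hδ (sub_pos.2 ht.1)
    linarith
  obtain ⟨c, hc, hcs⟩ := exists_hasDerivAt_eq_slope (fun t => u t - β t)
    (fun t => u' t - β' t) (by linarith : t₀ < t₀ + η)
    ((hu.continuousOn.sub hβ.continuousOn).mono hsub) fun t ht => by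
      have hn : Icc (0 : ℝ) T ∈ nhds t :=
        Icc_mem_nhds (ht₀.1.trans_lt ht.1) (by linarith [ht.2])
      have htT := hsub t (Ioo_subset_Icc_self ht)
      exact ((hu.hasDeriv t htT).hasDerivAt hn).sub ((hβ.hasDeriv t htT).hasDerivAt hn)
  have hpos := sub_pos.2 (hgrow c hc)
  rw [hcs, heq, sub_self, sub_zero, add_sub_cancel_left, div_pos_iff_of_pos_right hη] at hpos
  exact absurd (hle _ (hsub _ (right_mem_Icc.2 (by linarith)))) (not_le.2 (sub_pos.1 hpos))

end IsPeriodicSol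

section Conversion

variable {T : ℝ} {φ : ℝ ≃o ℝ} {a e f q : ℝ → ℝ} {σ : ℝ} {u u' : ℝ → ℝ}

theorem integral_comp_mul_deriv_eq_sub (hf : Continuous f)
    (hu : ∀ t ∈ Icc (0 : ℝ) T, HasDerivWithinAt u (u' t) (Icc (0 : ℝ) T) t)
    (hu' : ContinuousOn u' (Icc (0 : ℝ) T)) {t : ℝ} (ht : t ∈ Icc (0 : ℝ) T) :
    ∫ τ in (0 : ℝ)..t, f (u τ) * u' τ = (∫ x in (0 : ℝ)..u t, f x) - ∫ x in (0 : ℝ)..u 0, f x := by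
  have hsub : uIcc 0 t ⊆ Icc 0 T := by
    rw [uIcc_of_le ht.1]; exact Icc_subset_Icc_right ht.2
  rw [intervalIntegral.integral_interval_sub_left (hf.intervalIntegrable _ _)
    (hf.intervalIntegrable _ _)]
  refine intervalIntegral.integral_comp_mul_deriv'' (f := u) (g := f)
    (fun x hx => ((hu x (hsub hx)).continuousWithinAt).mono hsub) (fun x hx => ?_)
    (hu'.mono hsub) hf.continuousOn
  rw [min_eq_left ht.1, max_eq_right ht.1] at hx
  exact ((hu x ⟨hx.1.le, hx.2.le.trans ht.2⟩).hasDerivAt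
    (Icc_mem_nhds hx.1 (hx.2.trans_le ht.2))).hasDerivWithinAt

theorem intervalIntegrable_comp_mul_deriv (hf : Continuous f)
    (hu : ∀ t ∈ Icc (0 : ℝ) T, HasDerivWithinAt u (u' t) (Icc (0 : ℝ) T) t)
    (hu' : ContinuousOn u' (Icc (0 : ℝ) T)) {t : ℝ} (ht : t ∈ Icc (0 : ℝ) T) :
    IntervalIntegrable (fun τ => f (u τ) * u' τ) volume 0 t := by
  have hcu : ContinuousOn u (Icc (0 : ℝ) T) := fun t ht => (hu t ht).continuousWithinAt
  refine (((hf.comp_continuousOn hcu).mul hu').mono ?_).intervalIntegrable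
  rw [uIcc_of_le ht.1]
  exact Icc_subset_Icc_right ht.2

theorem IsPeriodicSol.isSolWE (hd : IsAdmissible T φ a e) (hf : Continuous f) (hq : Continuous q)
    (hu : IsPeriodicSol T φ a e (fun y => ∫ x in (0 : ℝ)..y, f x) q σ u u') :
    IsSolWE T φ f q a e σ u := by
  have hforce := hu.intervalIntegrable_force hd hq
  have hfI {t : ℝ} (ht : t ∈ Icc (0 : ℝ) T) := intervalIntegrable_comp_mul_deriv hf hu.hasDeriv
    hu.continuousOn_deriv ht
  refine ⟨u', fun t => (σ + e t - a t * q (u t)) - f (u t) * u' t,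
    ⟨hu.hasDeriv, hu.continuousOn_deriv, hu.periodic, hu.periodic_deriv⟩, ⟨?_, fun t ht => ?_⟩,
    ae_of_all _ fun t => by ring⟩
  · exact (intervalIntegrable_iff_integrableOn_Icc_of_le hd.T_pos.le).1
      (hforce.sub (hfI (right_mem_Icc.2 hd.T_pos.le)))
  · have hsub : uIcc 0 t ⊆ uIcc 0 T := by
      rw [uIcc_of_le ht.1, uIcc_of_le hd.T_pos.le]; exact Icc_subset_Icc_right ht.2
    rw [intervalIntegral.integral_sub (hforce.mono_set hsub) (hfI ht),
      integral_comp_mul_deriv_eq_sub hf hu.hasDeriv hu.continuousOn_deriv ht]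
    linarith [hu.equation t ht]

theorem IsSolWE.exists_isPeriodicSol (hd : IsAdmissible T φ a e) (hf : Continuous f)
    (h : IsSolWE T φ f q a e σ u) :
    ∃ u', IsPeriodicSol T φ a e (fun y => ∫ x in (0 : ℝ)..y, f x) q σ u u' := by
  obtain ⟨u', w, ⟨hder, hcont, hper, hper'⟩, ⟨hw, hphi⟩, hae⟩ := h
  refine ⟨u', hder, hcont, hper, hper', fun t ht => ?_⟩
  have hsub : uIcc 0 t ⊆ uIcc 0 T := by
    rw [uIcc_of_le ht.1, uIcc_of_le hd.T_pos.le]; exact Icc_subset_Icc_right ht.2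
  have hwI : IntervalIntegrable w volume 0 t :=
    ((intervalIntegrable_iff_integrableOn_Icc_of_le hd.T_pos.le).2 hw).mono_set hsub
  have hcongr : ∫ τ in (0 : ℝ)..t, (σ + e τ - a τ * q (u τ)) =
      ∫ τ in (0 : ℝ)..t, (w τ + f (u τ) * u' τ) := by
    refine intervalIntegral.integral_congr_ae_restrict ?_
    refine ae_restrict_of_ae_restrict_of_subset (t := Icc 0 T) ?_ ?_
    · rw [uIoc_of_le ht.1]
      exact Ioc_subset_Icc_self.trans (Icc_subset_Icc_right ht.2)
    · filter_upwards [hae] with τ hτ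
      linarith
  rw [hcongr, intervalIntegral.integral_add hwI
    (intervalIntegrable_comp_mul_deriv hf hder hcont ht),
    integral_comp_mul_deriv_eq_sub hf hder hcont ht, hphi t ht]
  ring

end Conversion

/-- Truncation of the real line to `[l, r]`. -/
def clamp (l r : ℝ) : C(ℝ, ℝ) := ⟨fun x => max l (min r x), by fun_prop⟩

theorem clamp_apply (l r x : ℝ) : clamp l r x = max l (min r x) := rfl

theorem clamp_of_mem {l r x : ℝ} (hx : x ∈ Icc l r) : clamp l r x = x := by
  rw [clamp_apply, min_eq_right hx.2, max_eq_right hx.1]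

theorem clamp_mem {l r : ℝ} (h : l ≤ r) (x : ℝ) : clamp l r x ∈ Icc l r :=
  ⟨le_max_left _ _, max_le h (min_le_left _ _)⟩

theorem clamp_le {l r x y : ℝ} (hl : l ≤ y) (hx : x ≤ y) : clamp l r x ≤ y :=
  max_le hl ((min_le_right _ _).trans hx)

theorem le_clamp {l r x y : ℝ} (hr : y ≤ r) (hx : y ≤ x) : y ≤ clamp l r x :=
  (le_min hr hx).trans (le_max_right _ _)

theorem exists_bound_comp_clamp (g : C(ℝ, ℝ)) {l r : ℝ} (h : l ≤ r) :
    ∃ C, ∀ x, |g.comp (clamp l r) x| ≤ C := by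
  obtain ⟨C, hC⟩ := (isCompact_Icc (a := l) (b := r)).exists_bound_of_continuousOn
    g.continuous.continuousOn
  exact ⟨C, fun x => hC _ (clamp_mem h x)⟩

/-- The periodic problem with nonlinearities truncated to `[l, r]`. -/
def IsAdmissible.truncated {T : ℝ} {φ : ℝ ≃o ℝ} {a e : ℝ → ℝ} (hd : IsAdmissible T φ a e)
    (F q : C(ℝ, ℝ)) {l r : ℝ} (h : l ≤ r) : LienardData where
  T := T
  φ := φ
  a := a
  e := e
  F := F.comp (clamp l r)
  q := q.comp (clamp l r)
  T_pos := hd.T_pos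
  φ_zero := hd.φ_zero
  integrable_a := hd.integrable_a
  integrable_e := hd.integrable_e
  integral_e := hd.integral_e
  bounded_F := exists_bound_comp_clamp F h
  bounded_q := exists_bound_comp_clamp q h

section Existence

variable {T : ℝ} {φ : ℝ ≃o ℝ} {a e : ℝ → ℝ}

theorem IsPeriodicSol.congr {F q G p : ℝ → ℝ} {σ : ℝ} {u u' : ℝ → ℝ} (hT : 0 ≤ T)
    (hu : IsPeriodicSol T φ a e F q σ u u') (hF : ∀ t ∈ Icc (0 : ℝ) T, F (u t) = G (u t))
    (hq : ∀ t ∈ Icc (0 : ℝ) T, q (u t) = p (u t)) : IsPeriodicSol T φ a e G p σ u u' := by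
  refine ⟨hu.hasDeriv, hu.continuousOn_deriv, hu.periodic, hu.periodic_deriv, fun t ht => ?_⟩
  rw [← hF t ht, ← hF 0 (left_mem_Icc.2 hT), hu.equation t ht]
  congr 1
  refine intervalIntegral.integral_congr fun τ hτ => ?_
  rw [uIcc_of_le ht.1] at hτ
  simp only [hq τ ⟨hτ.1, hτ.2.trans ht.2⟩]

variable {F q : C(ℝ, ℝ)} {σ l r : ℝ} {u u' : ℝ → ℝ}

theorem isPeriodicSol_truncated_iff (hT : 0 ≤ T) (hmem : ∀ t ∈ Icc (0 : ℝ) T, u t ∈ Icc l r) :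
    IsPeriodicSol T φ a e (F.comp (clamp l r)) (q.comp (clamp l r)) σ u u' ↔
      IsPeriodicSol T φ a e F q σ u u' :=
  ⟨fun h => h.congr hT (fun t ht => by simp [clamp_of_mem (hmem t ht)])
      (fun t ht => by simp [clamp_of_mem (hmem t ht)]),
    fun h => h.congr hT (fun t ht => by simp [clamp_of_mem (hmem t ht)])
      (fun t ht => by simp [clamp_of_mem (hmem t ht)])⟩

theorem differentiableAt_comp_clamp (hF : Differentiable ℝ F) {x : ℝ} (hx : x ∈ Ioo l r) :
    DifferentiableAt ℝ (F.comp (clamp l r)) x := by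
  refine (hF x).congr_of_eventuallyEq ?_
  filter_upwards [Ioo_mem_nhds hx.1 hx.2] with y hy
  simp [clamp_of_mem (Ioo_subset_Icc_self hy)]

theorem exists_lower_bound_of_tendsto {ωp : ℝ} (hbot : Tendsto q atBot atTop)
    (htop : Tendsto q atTop (nhds ωp)) : ∃ q₀, ∀ x, -q₀ ≤ q x := by
  obtain ⟨x₀, hx₀⟩ := eventually_atBot.1 (hbot.eventually_ge_atTop 0)
  obtain ⟨x₁, hx₁⟩ := eventually_atTop.1 (htop.eventually_const_le (sub_one_lt ωp))
  obtain ⟨C, hC⟩ := (isCompact_Icc (a := x₀) (b := x₁)).exists_bound_of_continuousOn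
    q.continuous.continuousOn
  refine ⟨|C| + |ωp - 1|, fun x => ?_⟩
  have h1 := abs_nonneg C
  have h2 := abs_nonneg (ωp - 1)
  rcases le_total x x₀ with h | h
  · linarith [hx₀ x h]
  rcases le_total x₁ x with h' | h'
  · linarith [hx₁ x h', neg_abs_le (ωp - 1)]
  · linarith [(abs_le.1 (hC x ⟨h, h'⟩)).1, le_abs_self C]

theorem eq_max_min_cases {m c₀ c₁ x : ℝ} (hc : c₀ ≤ c₁) (h : m = max c₀ (min c₁ (m + x))) :
    (m = c₁ ∧ 0 ≤ x) ∨ (m = c₀ ∧ x ≤ 0) ∨ (c₀ < m ∧ m < c₁ ∧ x = 0) := by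
  rcases le_or_gt c₁ (m + x) with h1 | h1
  · rw [min_eq_left h1, max_eq_right hc] at h
    exact Or.inl ⟨h, by linarith⟩
  rw [min_eq_right h1.le] at h
  rcases le_or_gt (m + x) c₀ with h2 | h2
  · rw [max_eq_left h2] at h
    exact Or.inr (Or.inl ⟨h, by linarith⟩)
  · rw [max_eq_right h2.le] at h
    exact Or.inr (Or.inr ⟨by linarith, by linarith, by linarith⟩)

theorem IsAdmissible.exists_truncated_sol (hd : IsAdmissible T φ a e) (F q : C(ℝ, ℝ))
    (hlr : l ≤ r) {β : ℝ → ℝ} (hβ : ContinuousOn β (Icc 0 T)) {c₀ c₁ : ℝ} (hc : c₀ ≤ c₁)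
    (s ε : ℝ) :
    ∃ (u u' : ℝ → ℝ) (σ m : ℝ),
      IsPeriodicSol T φ a e (F.comp (clamp l r)) (q.comp (clamp l r)) σ u u' ∧
      (∀ t ∈ Icc (0 : ℝ) T, u t ≤ β t + m) ∧ (∃ t ∈ Icc (0 : ℝ) T, u t = β t + m) ∧
      ((m = c₁ ∧ 0 ≤ ε * (σ - s)) ∨ (m = c₀ ∧ ε * (σ - s) ≤ 0) ∨
        (c₀ < m ∧ m < c₁ ∧ ε * (σ - s) = 0)) := by
  obtain ⟨v, σ, m, u', hsol, hle, ⟨t, ht⟩, -, hm⟩ :=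
    (hd.truncated F q hlr).exists_sol_with_feedback ⟨fun t => β t, hβ.domRestrict⟩ hc s ε
  have hext : ∀ τ (hτ : τ ∈ Icc (0 : ℝ) T), lineExt hd.T_pos.le v τ = v ⟨τ, hτ⟩ :=
    fun τ hτ => lineExt_of_mem hd.T_pos.le v hτ
  refine ⟨_, u', σ, m, hsol, fun τ hτ => ?_, ⟨t, t.2, ?_⟩, eq_max_min_cases hc hm⟩
  · exact (hext τ hτ).trans_le (hle ⟨τ, hτ⟩)
  · exact (hext t t.2).trans ht

end Existence

section Multiplicity

variable {T : ℝ} {φ : ℝ ≃o ℝ} {a e : ℝ → ℝ} {F q : C(ℝ, ℝ)}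

/-- There is a periodic solution whose mean lies below the limit `ωp` of `q`. -/
theorem IsAdmissible.exists_sol_mean_lt (hd : IsAdmissible T φ a e) {ωp q₀ R : ℝ}
    (hq₀ : ∀ x, -q₀ ≤ q x) (hR : ∀ x, R ≤ x → q x < ωp) :
    ∃ σ u u', σ < ωp ∧ IsPeriodicSol T φ a e F q σ u u' := by
  obtain ⟨B, hB0, hB⟩ := hd.exists_oscillation_bound ωp q₀
  have hlr : R ≤ R + B := by linarith
  obtain ⟨u, u', σ, m, hu, hle, ⟨t₀, ht₀, htouch⟩, hm⟩ := hd.exists_truncated_sol F q hlr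
    (β := fun _ => 0) continuousOn_const (le_refl (R + B)) 0 0
  have hmB : m = R + B := by
    rcases hm with h | h | h
    · exact h.1
    · exact h.1
    · linarith [h.1, h.2.1]
  obtain ⟨x, hx, hmax⟩ := (isCompact_Icc (a := R) (b := R + B)).exists_isMaxOn
    (nonempty_Icc.2 hlr) q.continuous.continuousOn
  have hσ : σ ≤ q x := hu.mean_le hd (ContinuousMap.continuous _) fun t _ => hmax (clamp_mem hlr _)
  have hσω : σ < ωp := hσ.trans_lt (hR x hx.1)
  have hosc := hB (F.comp (clamp R (R + B))) (q.comp (clamp R (R + B))) σ u u'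
    (ContinuousMap.continuous _) (ContinuousMap.continuous _)
    (fun y => hq₀ _) hσω.le hu
  refine ⟨σ, u, u', hσω, (isPeriodicSol_truncated_iff hd.T_pos.le fun t ht => ?_).1 hu⟩
  have h1 := hosc t ht t₀ ht₀
  have h2 := hle t ht
  constructor <;> linarith

/-- Periodic solutions whose mean is below `S < ωp` are bounded. -/
theorem IsAdmissible.exists_bound_of_mean_le (hd : IsAdmissible T φ a e) {ωp q₀ S : ℝ}
    (hq₀ : ∀ x, -q₀ ≤ q x) (hbot : Tendsto q atBot atTop) (htop : Tendsto q atTop (nhds ωp))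
    (hS : S < ωp) :
    ∃ L, ∀ σ u u', σ ≤ S → IsPeriodicSol T φ a e F q σ u u' →
      ∀ t ∈ Icc (0 : ℝ) T, |u t| ≤ L := by
  obtain ⟨B, hB0, hB⟩ := hd.exists_oscillation_bound S q₀
  obtain ⟨ρ, hSρ, hρω⟩ := exists_between hS
  obtain ⟨x₀, hx₀⟩ := eventually_atBot.1 (hbot.eventually_ge_atTop ρ)
  obtain ⟨x₁, hx₁⟩ := eventually_atTop.1 (htop.eventually_const_le hρω)
  refine ⟨|x₀| + |x₁| + B, fun σ u u' hσ hu t ht => ?_⟩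
  have hosc := hB F q σ u u' F.continuous q.continuous hq₀ hσ hu
  have hnot : ¬∀ τ ∈ Icc (0 : ℝ) T, ρ ≤ q (u τ) := fun h =>
    absurd (hu.le_mean hd q.continuous h) (by linarith)
  rw [abs_le]
  constructor
  · by_contra! hlt
    refine hnot fun τ hτ => hx₀ _ ?_
    linarith [hosc t ht τ hτ, neg_abs_le x₀, abs_nonneg x₁]
  · by_contra! hlt
    refine hnot fun τ hτ => hx₁ _ ?_
    linarith [hosc τ hτ t ht, le_abs_self x₁, abs_nonneg x₀]

/-- There is a periodic solution with the least possible mean, and this mean is below `ωp`. -/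
theorem IsAdmissible.exists_least_mean (hd : IsAdmissible T φ a e) {ωp q₀ R : ℝ}
    (hq₀ : ∀ x, -q₀ ≤ q x) (hbot : Tendsto q atBot atTop) (htop : Tendsto q atTop (nhds ωp))
    (hR : ∀ x, R ≤ x → q x < ωp) :
    ∃ s₀ β β', s₀ < ωp ∧ IsPeriodicSol T φ a e F q s₀ β β' ∧
      ∀ σ u u', IsPeriodicSol T φ a e F q σ u u' → s₀ ≤ σ := by
  obtain ⟨S, u₁, u₁', hS, hu₁⟩ := hd.exists_sol_mean_lt (F := F) hq₀ hR
  obtain ⟨L, hL⟩ := hd.exists_bound_of_mean_le (F := F) hq₀ hbot htop hS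
  have hT := hd.T_pos.le
  have hL₁ := hL S u₁ u₁' le_rfl hu₁
  have hL0 : -L ≤ L := by
    linarith [(abs_nonneg _).trans (hL₁ 0 (left_mem_Icc.2 hT))]
  have hu₁' := (isPeriodicSol_truncated_iff (l := -L) (r := L) hT
    fun t ht => abs_le.1 (hL₁ t ht)).2 hu₁
  obtain ⟨v, s₀, v', hvL, hv, hmin⟩ :=
    (hd.truncated F q hL0).exists_sol_with_least_mean hu₁' hL₁
  have hs₀S : s₀ ≤ S := hmin S u₁ u₁' hu₁' hL₁
  refine ⟨s₀, lineExt hT v, v', hs₀S.trans_lt hS,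
    (isPeriodicSol_truncated_iff hT fun t ht => abs_le.1 ?_).1 hv, fun σ u u' hu => ?_⟩
  · rw [lineExt_of_mem hT v ht]
    exact hvL _
  · by_contra! hlt
    have hub := hL σ u u' (by linarith) hu
    exact absurd (hmin σ u u' ((isPeriodicSol_truncated_iff hT
      fun t ht => abs_le.1 (hub t ht)).2 hu) hub) (not_le.2 hlt)

variable {s₀ s : ℝ} {β β' : ℝ → ℝ}

/-- The mean of a solution of the truncated problem touching `β` from below does not exceed that
of `β`. -/
theorem mean_le_of_touching (hd : IsAdmissible T φ a e) (hF : Differentiable ℝ F)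
    (hβ : IsPeriodicSol T φ a e F q s₀ β β') {L σ : ℝ} (hL : ∀ t ∈ Icc (0 : ℝ) T, |β t| < L)
    {u u' : ℝ → ℝ}
    (hu : IsPeriodicSol T φ a e (F.comp (clamp (-L) L)) (q.comp (clamp (-L) L)) σ u u')
    (hle : ∀ t ∈ Icc (0 : ℝ) T, u t ≤ β t) (htouch : ∃ t ∈ Icc (0 : ℝ) T, u t = β t) :
    σ ≤ s₀ := by
  by_contra! hlt
  obtain ⟨t, ht, heq⟩ := htouch
  have hβ' := (isPeriodicSol_truncated_iff hd.T_pos.le fun t ht => abs_le.1 (hL t ht).le).2 hβ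
  exact hu.not_touching hd (ContinuousMap.continuous _) hβ' hlt hle
    (fun τ hτ => differentiableAt_comp_clamp hF (abs_lt.1 (hL τ hτ))) t ht heq

/-- Below a solution there are solutions for every larger mean. -/
theorem IsAdmissible.exists_sol_below (hd : IsAdmissible T φ a e) {q₀ : ℝ}
    (hF : Differentiable ℝ F) (hq₀ : ∀ x, -q₀ ≤ q x) (hbot : Tendsto q atBot atTop)
    (hβ : IsPeriodicSol T φ a e F q s₀ β β') (hs : s₀ < s) :
    ∃ u u', IsPeriodicSol T φ a e F q s u u' ∧ ∀ t ∈ Icc (0 : ℝ) T, u t < β t := by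
  obtain ⟨B, hB0, hB⟩ := hd.exists_oscillation_bound s q₀
  obtain ⟨M, hM⟩ := isCompact_Icc.exists_bound_of_continuousOn hβ.continuousOn
  have hM' := fun t ht => abs_le.1 (hM t ht)
  obtain ⟨x₀, hx₀⟩ := eventually_atBot.1 (hbot.eventually_ge_atTop (s + 1))
  have hM0 : 0 ≤ M := (abs_nonneg _).trans (hM 0 (left_mem_Icc.2 hd.T_pos.le))
  set c₀ := min 0 (x₀ - M) with hc₀
  have hc₀0 : c₀ ≤ 0 := min_le_left _ _
  have hc₀x : c₀ ≤ x₀ - M := min_le_right _ _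
  set L := M - c₀ + B + |x₀| + 1 with hL
  have hx₀abs := abs_nonneg x₀
  have hβL : ∀ t ∈ Icc (0 : ℝ) T, |β t| < L := fun t ht =>
    (hM t ht).trans_lt (by linarith)
  obtain ⟨u, u', σ, m, hu, hle, ⟨t₀, ht₀, htouch⟩, hm⟩ := hd.exists_truncated_sol F q
    (by linarith : -L ≤ L) hβ.continuousOn hc₀0 s 1
  rw [one_mul] at hm
  have hne : m = 0 → σ ≤ s₀ := fun h0 => by
    rw [h0, add_zero] at htouch
    exact mean_le_of_touching hd hF hβ hβL hu (fun t ht => by linarith [hle t ht])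
      ⟨t₀, ht₀, htouch⟩
  rcases hm with ⟨h1, h2⟩ | ⟨h1, h2⟩ | ⟨h1, h2, h3⟩
  · linarith [hne h1]
  · have : s + 1 ≤ σ := hu.le_mean hd (ContinuousMap.continuous _) fun t ht =>
      hx₀ _ (clamp_le (by linarith [neg_abs_le x₀]) (by linarith [hle t ht, (hM' t ht).2]))
    linarith
  · obtain rfl : σ = s := by linarith
    have hosc := hB (F.comp (clamp (-L) L)) (q.comp (clamp (-L) L)) σ u u'
      (ContinuousMap.continuous _) (ContinuousMap.continuous _)
      (fun y => hq₀ _) le_rfl hu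
    refine ⟨u, u', (isPeriodicSol_truncated_iff hd.T_pos.le fun t ht => ?_).1 hu,
      fun t ht => by linarith [hle t ht]⟩
    constructor
    · linarith [hosc t ht t₀ ht₀, (hM' t₀ ht₀).1]
    · linarith [hle t ht, (hM' t ht).2]

/-- For means between that of a given solution and `ωp` there is a solution which is not
below the given one. -/
theorem IsAdmissible.exists_sol_not_below (hd : IsAdmissible T φ a e) {ωp q₀ : ℝ}
    (hF : Differentiable ℝ F) (hq₀ : ∀ x, -q₀ ≤ q x) (htop : Tendsto q atTop (nhds ωp))
    (hβ : IsPeriodicSol T φ a e F q s₀ β β') (hs : s₀ < s) (hsω : s < ωp) :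
    ∃ u u', IsPeriodicSol T φ a e F q s u u' ∧ ∃ t ∈ Icc (0 : ℝ) T, β t < u t := by
  obtain ⟨B, hB0, hB⟩ := hd.exists_oscillation_bound s q₀
  obtain ⟨M, hM⟩ := isCompact_Icc.exists_bound_of_continuousOn hβ.continuousOn
  have hM' := fun t ht => abs_le.1 (hM t ht)
  obtain ⟨ρ, hsρ, hρω⟩ := exists_between hsω
  obtain ⟨x₁, hx₁⟩ := eventually_atTop.1 (htop.eventually_const_le hρω)
  have hM0 : 0 ≤ M := (abs_nonneg _).trans (hM 0 (left_mem_Icc.2 hd.T_pos.le))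
  set c₁ := max 0 (x₁ + M + B) with hc₁
  have hc₁0 : 0 ≤ c₁ := le_max_left _ _
  have hc₁x : x₁ + M + B ≤ c₁ := le_max_right _ _
  set L := M + c₁ + B + |x₁| + 1 with hL
  have hx₁abs := abs_nonneg x₁
  have hβL : ∀ t ∈ Icc (0 : ℝ) T, |β t| < L := fun t ht =>
    (hM t ht).trans_lt (by linarith)
  obtain ⟨u, u', σ, m, hu, hle, ⟨t₀, ht₀, htouch⟩, hm⟩ := hd.exists_truncated_sol F q
    (by linarith : -L ≤ L) hβ.continuousOn hc₁0 s (-1)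
  have hne : m = 0 → σ ≤ s₀ := fun h0 => by
    rw [h0, add_zero] at htouch
    exact mean_le_of_touching hd hF hβ hβL hu (fun t ht => by linarith [hle t ht])
      ⟨t₀, ht₀, htouch⟩
  have hosc := hB (F.comp (clamp (-L) L)) (q.comp (clamp (-L) L)) σ u u'
    (ContinuousMap.continuous _) (ContinuousMap.continuous _)
    (fun y => hq₀ _)
  rcases hm with ⟨h1, h2⟩ | ⟨h1, h2⟩ | ⟨h1, h2, h3⟩
  · have hosc' := hosc (by linarith) hu
    have : ρ ≤ σ := hu.le_mean hd (ContinuousMap.continuous _) fun t ht =>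
      hx₁ _ (le_clamp (by linarith [le_abs_self x₁])
        (by linarith [hosc' t ht t₀ ht₀, (hM' t₀ ht₀).1]))
    linarith
  · linarith [hne h1]
  · obtain rfl : σ = s := by linarith
    refine ⟨u, u', (isPeriodicSol_truncated_iff hd.T_pos.le fun t ht => ?_).1 hu,
      t₀, ht₀, by linarith⟩
    constructor
    · linarith [hosc le_rfl hu t ht t₀ ht₀, (hM' t₀ ht₀).1]
    · linarith [hle t ht, (hM' t ht).2]

end Multiplicity

/-- If `q(u) → +∞` as `u → −∞` and `q(u) → ω₊ ∈ ℝ` as `u → +∞` with `q(u) < ω₊` for all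
large `u`, then there is `s₀ < ω₊` such that `(WE_s)` has no `T`-periodic solution for
`s < s₀`, at least one for `s = s₀`, at least two for `s₀ < s < ω₊`, and at least one
for `s ≥ ω₊`. -/
theorem statement2
    (T : ℝ) (hT : 0 < T)
    (φ f q a e : ℝ → ℝ)
    (hφmono : StrictMono φ) (hφcont : Continuous φ)
    (hφsurj : Function.Surjective φ) (hφ0 : φ 0 = 0)
    (hf : Continuous f) (hq : Continuous q)
    (ha_meas : Measurable a) (ha_bdd : ∃ C : ℝ, ∀ᵐ t ∂(muT T), |a t| ≤ C)
    (ha_nonneg : ∀ᵐ t ∂(muT T), 0 ≤ a t)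
    (ha_mean : (1 / T) * ∫ t in Icc (0:ℝ) T, a t = 1)
    (he_meas : Measurable e) (he_bdd : ∃ C : ℝ, ∀ᵐ t ∂(muT T), |e t| ≤ C)
    (he_mean : (1 / T) * ∫ t in Icc (0:ℝ) T, e t = 0)
    (ωp : ℝ)
    (hq_bot : Tendsto q atBot atTop) (hq_top : Tendsto q atTop (nhds ωp))
    (hq_lt : ∃ R : ℝ, ∀ u : ℝ, R ≤ u → q u < ωp) :
    ∃ s₀ : ℝ, s₀ < ωp ∧
      (∀ s : ℝ, s < s₀ → ¬∃ u : ℝ → ℝ, IsSolWE T φ f q a e s u) ∧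
      (∃ u : ℝ → ℝ, IsSolWE T φ f q a e s₀ u) ∧
      (∀ s : ℝ, s₀ < s → s < ωp → ∃ u₁ u₂ : ℝ → ℝ, IsSolWE T φ f q a e s u₁ ∧
        IsSolWE T φ f q a e s u₂ ∧ ∃ t ∈ Icc (0:ℝ) T, u₁ t ≠ u₂ t) ∧
      (∀ s : ℝ, ωp ≤ s → ∃ u : ℝ → ℝ, IsSolWE T φ f q a e s u) := by
  obtain ⟨R, hR⟩ := hq_lt
  let φ' : ℝ ≃o ℝ := hφmono.orderIsoOfSurjective φ hφsurj
  have integrable_of_bounded : ∀ {g : ℝ → ℝ}, Measurable g →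
      (∃ C : ℝ, ∀ᵐ t ∂(muT T), |g t| ≤ C) → IntegrableOn g (Icc 0 T) :=
    fun hg ⟨C, hC⟩ => Measure.integrableOn_of_bounded (by simp) hg.aestronglyMeasurable hC
  have integral_eq : ∀ g : ℝ → ℝ, ∫ t in (0 : ℝ)..T, g t = ∫ t in Icc (0 : ℝ) T, g t := fun g => by
    rw [intervalIntegral.integral_of_le hT.le, integral_Icc_eq_integral_Ioc]
  have hd : IsAdmissible T φ' a e :=
    { T_pos := hT
      φ_zero := hφ0
      integrable_a := integrable_of_bounded ha_meas ha_bdd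
      integrable_e := integrable_of_bounded he_meas he_bdd
      bounded_a := ha_bdd
      nonneg_a := ha_nonneg
      integral_a := by
        rw [integral_eq]
        field_simp at ha_mean
        exact ha_mean
      integral_e := by
        rw [integral_eq]
        exact (mul_eq_zero.1 he_mean).resolve_left (by positivity) }
  have hFdiff : Differentiable ℝ fun y => ∫ x in (0 : ℝ)..y, f x := fun y =>
    (hf.integral_hasStrictDerivAt 0 y).hasDerivAt.differentiableAt
  let F : C(ℝ, ℝ) := ⟨fun y => ∫ x in (0 : ℝ)..y, f x, hFdiff.continuous⟩
  let p : C(ℝ, ℝ) := ⟨q, hq⟩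
  obtain ⟨q₀, hq₀⟩ := exists_lower_bound_of_tendsto (q := p) hq_bot hq_top
  obtain ⟨s₀, β, β', hs₀, hβ, hmin⟩ := hd.exists_least_mean (F := F) hq₀ hq_bot hq_top hR
  have toSol : ∀ {σ : ℝ} {u u' : ℝ → ℝ}, IsPeriodicSol T φ' a e F p σ u u' →
      IsSolWE T φ f q a e σ u := fun h => h.isSolWE hd hf hq
  refine ⟨s₀, hs₀, fun s hs ⟨u, hu⟩ => ?_, ⟨β, toSol hβ⟩, fun s hs hsω => ?_, fun s hs => ?_⟩
  · obtain ⟨u', hu'⟩ := IsSolWE.exists_isPeriodicSol (φ := φ') hd hf hu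
    exact absurd (hmin s u u' hu') (not_le.2 hs)
  · obtain ⟨u₁, u₁', hu₁, hlt⟩ := hd.exists_sol_below hFdiff hq₀ hq_bot hβ hs
    obtain ⟨u₂, u₂', hu₂, t, ht, hgt⟩ := hd.exists_sol_not_below hFdiff hq₀ hq_top hβ hs hsω
    exact ⟨u₁, u₂, toSol hu₁, toSol hu₂, t, ht, ((hlt t ht).trans hgt).ne⟩
  · obtain ⟨u, u', hu, -⟩ := hd.exists_sol_below hFdiff hq₀ hq_bot hβ (hs₀.trans_le hs)
    exact ⟨u, toSol hu⟩
end
end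

section
/- Let h : [0,T]×ℝ → ℝ be a Carathéodory function satisfying condition (A₀). Let a > 0 and let α ∈ 𝔇 be such that (φ(α'(t)))' + f(α(t))α'(t) + h(t,α(t)) ≥ a for a.e. t ∈ [0,T]. Then α is a strict lower solution of (φ(u'))' + f(u)u' + h(t,u) = 0; in particular, every T-periodic solution u of this equation with u(t) ≥ α(t) for all t ∈ [0,T] satisfies u(t) > α(t) for all t ∈ [0,T]. -/
open MeasureTheory Set Filter

noncomputable section

/-- `h : [0,T] × ℝ → ℝ` is a Carathéodory function: measurable in `t`, continuous in `u`
for a.e. `t`, and locally `L¹`-dominated. -/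
def Caratheodory (T : ℝ) (h : ℝ → ℝ → ℝ) : Prop :=
  (∀ u : ℝ, Measurable fun t => h t u) ∧
    (∀ᵐ t ∂(muT T), Continuous fun u => h t u) ∧
    ∀ r : ℝ, 0 < r → ∃ γ : ℝ → ℝ, IntegrableOn γ (Icc (0:ℝ) T) ∧
      ∀ᵐ t ∂(muT T), ∀ u : ℝ, |u| ≤ r → |h t u| ≤ γ t

/-- `u` is a `T`-periodic solution of `(φ(u'))' + f(u)u' + h(t,u) = 0`. -/
def IsSolE (T : ℝ) (φ f : ℝ → ℝ) (h : ℝ → ℝ → ℝ) (u : ℝ → ℝ) : Prop :=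
  ∃ u' w : ℝ → ℝ, IsC1Periodic T u u' ∧ IsACPhiDeriv T φ u' w ∧
    ∀ᵐ t ∂(muT T), w t + f (u t) * u' t + h t (u t) = 0

/-- Condition `(A₀)`: local uniform control of `h(t,u) − h(t,u₀)` for a.e. `t`. -/
def CondA0 (T : ℝ) (h : ℝ → ℝ → ℝ) : Prop :=
  ∀ t₀ ∈ Icc (0:ℝ) T, ∀ u₀ : ℝ, ∀ ε : ℝ, 0 < ε → ∃ δ : ℝ, 0 < δ ∧
    ∀ᵐ t ∂(muT T), |t - t₀| < δ → ∀ u : ℝ, |u - u₀| < δ → |h t u - h t u₀| < ε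

/-- First-order condition: at a minimum point over `[a,b]`, the derivative is nonnegative in every
direction pointing into the interval. -/
lemma IsMinOn.hasDerivWithinAt_mul_sub_nonneg {v : ℝ → ℝ} {a b v₀ t s : ℝ}
    (hmin : IsMinOn v (Icc a b) t) (hv : HasDerivWithinAt v v₀ (Icc a b) t)
    (ht : t ∈ Icc a b) (hs : s ∈ Icc a b) : 0 ≤ v₀ * (s - t) := by
  have hseg : segment ℝ t s ⊆ Icc a b := (convex_Icc a b).segment_subset ht hs
  have := hmin.localize.hasFDerivWithinAt_nonneg hv.hasFDerivWithinAt
    (sub_mem_posTangentConeAt_of_segment_subset hseg)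
  simpa [mul_comm] using this

/-- A nonnegative `C¹` function with periodic boundary conditions that vanishes somewhere on `[0,T]`
has a zero in `[0,T)` at which its derivative vanishes too. -/
lemma IsC1Periodic.exists_zero_deriv_zero {T : ℝ} (hT : 0 < T) {v v' : ℝ → ℝ}
    (hv : IsC1Periodic T v v') (hnonneg : ∀ t ∈ Icc (0:ℝ) T, 0 ≤ v t)
    {t : ℝ} (ht : t ∈ Icc (0:ℝ) T) (hvt : v t = 0) :
    ∃ t₀ ∈ Ico (0:ℝ) T, v t₀ = 0 ∧ v' t₀ = 0 := by
  obtain ⟨hd, -, hper, hper'⟩ := hv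
  have h0 : (0:ℝ) ∈ Icc (0:ℝ) T := ⟨le_rfl, hT.le⟩
  have h1 : T ∈ Icc (0:ℝ) T := ⟨hT.le, le_rfl⟩
  have key : ∀ r ∈ Icc (0:ℝ) T, v r = 0 → ∀ s ∈ Icc (0:ℝ) T, 0 ≤ v' r * (s - r) := by
    intro r hr hvr s hs
    have hmin : IsMinOn v (Icc (0:ℝ) T) r := isMinOn_iff.2 fun x hx => hvr ▸ hnonneg x hx
    exact hmin.hasDerivWithinAt_mul_sub_nonneg (hd r hr) hr hs
  by_cases hint : 0 < t ∧ t < T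
  · refine ⟨t, ⟨ht.1, hint.2⟩, hvt, ?_⟩
    have k0 := key t ht hvt 0 h0
    have k1 := key t ht hvt T h1
    apply le_antisymm
    · nlinarith [hint.1]
    · exact nonneg_of_mul_nonneg_left k1 (sub_pos.2 hint.2)
  · have hv0 : v 0 = 0 := by
      rcases eq_or_lt_of_le ht.1 with h | h
      · rwa [← h] at hvt
      · have : t = T := le_antisymm ht.2 (not_lt.1 fun hlt => hint ⟨h, hlt⟩)
        rw [hper, ← this, hvt]
    refine ⟨0, ⟨le_rfl, hT⟩, hv0, ?_⟩
    have k0 := key 0 h0 hv0 T h1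
    have k1 := key T h1 (hper ▸ hv0) 0 h0
    rw [← hper'] at k1
    apply le_antisymm
    · nlinarith
    · nlinarith

/-- Increments of `φ ∘ u'` are integrals of its density. -/
lemma IsACPhiDeriv.sub_eq_integral {T : ℝ} {φ u' w : ℝ → ℝ} (hu : IsACPhiDeriv T φ u' w)
    {s t : ℝ} (hs : s ∈ Icc (0:ℝ) T) (ht : t ∈ Icc (0:ℝ) T) (hst : s ≤ t) :
    IntervalIntegrable w volume s t ∧ φ (u' t) - φ (u' s) = ∫ τ in s..t, w τ := by
  have hint : ∀ a ∈ Icc (0:ℝ) T, ∀ b ∈ Icc (0:ℝ) T, a ≤ b → IntervalIntegrable w volume a b :=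
    fun a ha b hb hab => (intervalIntegrable_iff_integrableOn_Icc_of_le hab).2
      (hu.1.mono_set (Icc_subset_Icc ha.1 hb.2))
  have h0 : (0:ℝ) ∈ Icc (0:ℝ) T := ⟨le_rfl, hs.1.trans hs.2⟩
  refine ⟨hint s hs t ht hst, ?_⟩
  rw [hu.2 t ht, hu.2 s hs,
    ← intervalIntegral.integral_add_adjacent_intervals (hint 0 h0 s hs hs.1) (hint s hs t ht hst)]
  ring

/-- If `φ ∘ u'` and `φ ∘ α'` agree at `t₀` and the density of the former is a.e. smaller
than that of the latter by a fixed amount on `[t₀,t₁]`, then `u' < α'` on `(t₀,t₁]`. -/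
lemma IsACPhiDeriv.lt_of_density_le {T : ℝ} {φ u' α' w wα : ℝ → ℝ} (hφ : StrictMono φ)
    (hu : IsACPhiDeriv T φ u' w) (hα : IsACPhiDeriv T φ α' wα)
    {t₀ t₁ d : ℝ} (h₀ : t₀ ∈ Icc (0:ℝ) T) (h₁ : t₁ ∈ Icc (0:ℝ) T) (hd : 0 < d)
    (heq : u' t₀ = α' t₀) (hle : ∀ᵐ t ∂(muT T), t ∈ Icc t₀ t₁ → w t + d ≤ wα t) :
    ∀ t ∈ Ioc t₀ t₁, u' t < α' t := by
  intro t ht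
  have htT : t ∈ Icc (0:ℝ) T := ⟨h₀.1.trans ht.1.le, ht.2.trans h₁.2⟩
  obtain ⟨hiu, hu⟩ := hu.sub_eq_integral h₀ htT ht.1.le
  obtain ⟨hiα, hα⟩ := hα.sub_eq_integral h₀ htT ht.1.le
  have hae : ∀ᵐ s ∂(volume.restrict (Icc t₀ t)), w s + d ≤ wα s := by
    have hsub : Icc t₀ t ⊆ Icc (0:ℝ) T := Icc_subset_Icc h₀.1 htT.2
    filter_upwards [ae_restrict_of_ae_restrict_of_subset hsub hle,
      ae_restrict_mem measurableSet_Icc] with s hs hmem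
    exact hs ⟨hmem.1, hmem.2.trans ht.2⟩
  have hmono := intervalIntegral.integral_mono_ae_restrict ht.1.le
    (hiu.add (intervalIntegrable_const (c := d))) hiα hae
  rw [intervalIntegral.integral_add hiu intervalIntegrable_const,
    intervalIntegral.integral_const, smul_eq_mul] at hmono
  have hpos : 0 < (t - t₀) * d := mul_pos (sub_pos.2 ht.1) hd
  rw [heq] at hu
  exact hφ.lt_iff_lt.1 (by linarith)

/-- If `h` is Carathéodory, satisfies `(A₀)`, and `α ∈ 𝔇` satisfies
`(φ(α'))' + f(α)α' + h(t,α) ≥ c > 0` a.e., then `α` is a strict lower solution of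
`(φ(u'))' + f(u)u' + h(t,u) = 0`: the differential inequality holds strictly a.e., and
every `T`-periodic solution `u` with `u ≥ α` on `[0,T]` satisfies `u > α` on `[0,T]`. -/
theorem statement3
    (T : ℝ) (hT : 0 < T)
    (φ f : ℝ → ℝ)
    (hφmono : StrictMono φ) (hφcont : Continuous φ)
    (hφsurj : Function.Surjective φ) (hφ0 : φ 0 = 0)
    (hf : Continuous f)
    (h : ℝ → ℝ → ℝ) (hCar : Caratheodory T h) (hA0 : CondA0 T h)
    (c : ℝ) (hc : 0 < c)
    (α α' wα : ℝ → ℝ)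
    (hα : IsC1Periodic T α α') (hαAC : IsACPhiDeriv T φ α' wα)
    (hαineq : ∀ᵐ t ∂(muT T), c ≤ wα t + f (α t) * α' t + h t (α t)) :
    (∀ᵐ t ∂(muT T), 0 < wα t + f (α t) * α' t + h t (α t)) ∧
      ∀ u : ℝ → ℝ, IsSolE T φ f h u → (∀ t ∈ Icc (0:ℝ) T, α t ≤ u t) →
        ∀ t ∈ Icc (0:ℝ) T, α t < u t := by
  refine ⟨hαineq.mono fun t ht => hc.trans_le ht, ?_⟩
  rintro u ⟨u', w, hu, huAC, hueq⟩ hle t ht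
  by_contra hnot
  have hut : u t - α t = 0 := sub_eq_zero.2 (le_antisymm (not_lt.1 hnot) (hle t ht))
  have hv : IsC1Periodic T (fun t => u t - α t) (fun t => u' t - α' t) :=
    ⟨fun s hs => (hu.1 s hs).sub (hα.1 s hs), hu.2.1.sub hα.2.1,
      by simp only [hu.2.2.1, hα.2.2.1], by simp only [hu.2.2.2, hα.2.2.2]⟩
  obtain ⟨t₀, ht₀, hv0, hv0'⟩ :=
    hv.exists_zero_deriv_zero hT (fun s hs => sub_nonneg.2 (hle s hs)) ht hut
  have hu0 : u t₀ = α t₀ := sub_eq_zero.1 hv0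
  have hu0' : u' t₀ = α' t₀ := sub_eq_zero.1 hv0'
  have ht₀T : t₀ ∈ Icc (0:ℝ) T := ⟨ht₀.1, ht₀.2.le⟩
  have hcu : ContinuousOn u (Icc 0 T) := fun s hs => (hu.1 s hs).continuousWithinAt
  have hcα : ContinuousOn α (Icc 0 T) := fun s hs => (hα.1 s hs).continuousWithinAt
  obtain ⟨δ, hδ, hA⟩ := hA0 t₀ ht₀T (α t₀) (c / 4) (by linarith)
  -- the damping terms are close near `t₀`
  have hcont : ContinuousOn (fun s => f (u s) * u' s - f (α s) * α' s) (Icc 0 T) :=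
    ((hf.comp_continuousOn hcu).mul hu.2.1).sub ((hf.comp_continuousOn hcα).mul hα.2.1)
  have hdamp : ∀ᶠ s in nhdsWithin t₀ (Icc 0 T), -(c / 4) < f (u s) * u' s - f (α s) * α' s :=
    (hcont t₀ ht₀T).eventually_const_lt (by simp only [hu0, hu0']; linarith)
  have hunear : ∀ᶠ s in nhdsWithin t₀ (Icc 0 T), |u s - α t₀| < δ :=
    ((hcu t₀ ht₀T).sub continuousWithinAt_const).abs.eventually_lt_const (by simpa [hu0] using hδ)
  have hαnear : ∀ᶠ s in nhdsWithin t₀ (Icc 0 T), |α s - α t₀| < δ :=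
    ((hcα t₀ ht₀T).sub continuousWithinAt_const).abs.eventually_lt_const (by simpa using hδ)
  obtain ⟨η, hη, hball⟩ := Metric.mem_nhdsWithin_iff.1 (hdamp.and (hunear.and hαnear))
  obtain ⟨t₁, ht₀₁, ht₁⟩ : ∃ t₁, t₀ < t₁ ∧ t₁ < min T (min (t₀ + δ) (t₀ + η)) :=
    exists_between (by simp [ht₀.2, hδ, hη])
  simp only [lt_min_iff] at ht₁
  have ht₁T : t₁ ∈ Icc (0:ℝ) T := ⟨ht₀.1.trans ht₀₁.le, ht₁.1.le⟩
  have hsub : Icc t₀ t₁ ⊆ Icc 0 T := Icc_subset_Icc ht₀.1 ht₁T.2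
  have hdens : ∀ᵐ s ∂(muT T), s ∈ Icc t₀ t₁ → w s + c / 4 ≤ wα s := by
    filter_upwards [hαineq, hueq, hA] with s hsα hsu hsA hs
    have habs : |s - t₀| = s - t₀ := abs_of_nonneg (sub_nonneg.2 hs.1)
    obtain ⟨hd, hus, hαs⟩ := hball ⟨by
      rw [Metric.mem_ball, Real.dist_eq, habs]; linarith [hs.2, ht₁.2.2], hsub hs⟩
    have hsδ : |s - t₀| < δ := by rw [habs]; linarith [hs.2, ht₁.2.1]
    have h1 := abs_lt.1 (hsA hsδ (u s) hus)
    have h2 := abs_lt.1 (hsA hsδ (α s) hαs)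
    linarith [h1.1, h2.2]
  have hlt := huAC.lt_of_density_le hφmono hαAC ht₀T ht₁T (by linarith) hu0' hdens
  have hanti : StrictAntiOn (fun s => u s - α s) (Icc t₀ t₁) := by
    refine strictAntiOn_of_hasDerivWithinAt_neg (f' := fun s => u' s - α' s) (convex_Icc t₀ t₁)
      ((hcu.sub hcα).mono hsub) (fun s hs => ?_) (fun s hs => ?_)
    · exact (hv.1 s (hsub (interior_subset hs))).mono (interior_subset.trans hsub)
    · rw [interior_Icc] at hs
      exact sub_neg.2 (hlt s ⟨hs.1, hs.2.le⟩)
  have hneg := hanti (left_mem_Icc.2 ht₀₁.le) (right_mem_Icc.2 ht₀₁.le) ht₀₁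
  simp only [hv0] at hneg
  linarith [hle t₁ ht₁T]
end
end

section
/- Let h : [0,T]×ℝ → ℝ be a Carathéodory function. (i) If there exists d₁ > 0 such that ∫₀ᵀ h(t,u(t)) dt ≠ 0 for every u ∈ C¹_T with u(t) ≥ d₁ for all t ∈ [0,T], then every T-periodic solution u of (φ(u'))' + λf(u)u' + λh(t,u) = 0 with λ ∈ (0,1] satisfies min u < d₁. (ii) If there exists d₂ > 0 such that ∫₀ᵀ h(t,u(t)) dt ≠ 0 for every u ∈ C¹_T with u(t) ≤ −d₂ for all t ∈ [0,T], then every T-periodic solution u of the same λ-equation with λ ∈ (0,1] satisfies max u > −d₂. -/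
open MeasureTheory Set Filter

noncomputable section

/-- `u` is a `T`-periodic solution of `(φ(u'))' + λ f(u)u' + λ h(t,u) = 0`. -/
def IsSolLam (T : ℝ) (φ f : ℝ → ℝ) (h : ℝ → ℝ → ℝ) (lam : ℝ) (u : ℝ → ℝ) : Prop :=
  ∃ u' w : ℝ → ℝ, IsC1Periodic T u u' ∧ IsACPhiDeriv T φ u' w ∧
    ∀ᵐ t ∂(muT T), w t + lam * (f (u t) * u' t) + lam * h t (u t) = 0

/-- The integral of `f(u) u'` vanishes over a period. -/
theorem IsC1Periodic.intervalIntegral_comp_mul_deriv_eq_zero {T : ℝ} (hT : 0 ≤ T)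
    {f u u' : ℝ → ℝ} (hf : Continuous f) (hu : IsC1Periodic T u u') :
    ∫ t in (0:ℝ)..T, f (u t) * u' t = 0 := by
  obtain ⟨hderiv, hcont, hper, -⟩ := hu
  have hucont : ContinuousOn u (Icc 0 T) := fun t ht => (hderiv t ht).continuousWithinAt
  have hF (x : ℝ) : HasDerivAt (fun y => ∫ s in (0:ℝ)..y, f s) (f x) x :=
    hf.integral_hasStrictDerivAt 0 x |>.hasDerivAt
  have hFcont : Continuous fun y => ∫ s in (0:ℝ)..y, f s :=
    continuous_iff_continuousAt.2 fun x => (hF x).continuousAt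
  rw [intervalIntegral.integral_eq_sub_of_hasDerivAt_of_le
    (f := fun t => ∫ s in (0:ℝ)..u t, f s) hT (hFcont.comp_continuousOn hucont)
    (fun t ht => (hF (u t)).comp t
      ((hderiv t (Ioo_subset_Icc_self ht)).hasDerivAt (Icc_mem_nhds ht.1 ht.2)))]
  · simp [hper]
  · exact ((hf.comp_continuousOn hucont).mul hcont).intervalIntegrable_of_Icc hT

/-- Along a `T`-periodic solution, `h(t,u(t))` has zero mean. -/
theorem IsSolLam.exists_isC1Periodic_integral_eq_zero {T : ℝ} (hT : 0 ≤ T) {φ f : ℝ → ℝ}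
    (hf : Continuous f) {h : ℝ → ℝ → ℝ} {lam : ℝ} (hlam : lam ≠ 0) {u : ℝ → ℝ}
    (hu : IsSolLam T φ f h lam u) :
    ∃ u', IsC1Periodic T u u' ∧ ∫ t in Icc (0:ℝ) T, h t (u t) = 0 := by
  obtain ⟨u', w, hper, ⟨hw, hφw⟩, heq⟩ := hu
  refine ⟨u', hper, ?_⟩
  have hucont : ContinuousOn u (Icc 0 T) := fun t ht => (hper.1 t ht).continuousWithinAt
  have hfu : IntegrableOn (fun t => f (u t) * u' t) (Icc 0 T) :=
    ((hf.comp_continuousOn hucont).mul hper.2.1).integrableOn_Icc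
  have hfu_zero : ∫ t in Icc (0:ℝ) T, f (u t) * u' t = 0 := by
    rw [integral_Icc_eq_integral_Ioc, ← intervalIntegral.integral_of_le hT]
    exact hper.intervalIntegral_comp_mul_deriv_eq_zero hT hf
  have hw_zero : ∫ t in Icc (0:ℝ) T, w t = 0 := by
    rw [integral_Icc_eq_integral_Ioc, ← intervalIntegral.integral_of_le hT]
    have hend := hφw T ⟨hT, le_rfl⟩
    rw [← hper.2.2.2] at hend
    linarith
  have hae : ∀ᵐ t ∂volume.restrict (Icc 0 T),
      h t (u t) = -lam⁻¹ * w t - f (u t) * u' t := by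
    filter_upwards [heq] with t ht
    field_simp
    linear_combination ht
  rw [integral_congr_ae hae, integral_sub (hw.const_mul _) hfu, integral_const_mul,
    hw_zero, hfu_zero]
  simp

/-- (i) If `∫₀ᵀ h(t,u(t)) dt ≠ 0` for every `u ∈ C¹_T` with `u ≥ d₁ > 0`, then every
`T`-periodic solution of `(φ(u'))' + λf(u)u' + λh(t,u) = 0`, `λ ∈ (0,1]`, satisfies
`min u < d₁`.  (ii) The symmetric statement at `−d₂`. -/
theorem statement4
    (T : ℝ) (hT : 0 < T)
    (φ f : ℝ → ℝ)
    (hφmono : StrictMono φ) (hφcont : Continuous φ)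
    (hφsurj : Function.Surjective φ) (hφ0 : φ 0 = 0)
    (hf : Continuous f)
    (h : ℝ → ℝ → ℝ) (hCar : Caratheodory T h) :
    (∀ d₁ : ℝ, 0 < d₁ →
      (∀ u u' : ℝ → ℝ, IsC1Periodic T u u' → (∀ t ∈ Icc (0:ℝ) T, d₁ ≤ u t) →
        (∫ t in Icc (0:ℝ) T, h t (u t)) ≠ 0) →
      ∀ lam ∈ Ioc (0:ℝ) 1, ∀ u : ℝ → ℝ, IsSolLam T φ f h lam u →
        ∃ t ∈ Icc (0:ℝ) T, u t < d₁) ∧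
    (∀ d₂ : ℝ, 0 < d₂ →
      (∀ u u' : ℝ → ℝ, IsC1Periodic T u u' → (∀ t ∈ Icc (0:ℝ) T, u t ≤ -d₂) →
        (∫ t in Icc (0:ℝ) T, h t (u t)) ≠ 0) →
      ∀ lam ∈ Ioc (0:ℝ) 1, ∀ u : ℝ → ℝ, IsSolLam T φ f h lam u →
        ∃ t ∈ Icc (0:ℝ) T, -d₂ < u t) := by
  refine ⟨fun d₁ _ hne lam hlam u hu => ?_, fun d₂ _ hne lam hlam u hu => ?_⟩ <;>
  · obtain ⟨u', hper, hzero⟩ := hu.exists_isC1Periodic_integral_eq_zero hT.le hf hlam.1.ne'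
    by_contra! hbound
    exact hne u u' hper hbound hzero
end
end
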